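/- arXiv:1602.08925 — 4 statements merged into one kernel-verified Lean document; each statement's English description precedes it below -/
import Mathlib

section
/- For every integer k ≥ 1, the classes Σ_{2k} and Σ_{2k-1} of the local hierarchy coincide: a distributed language is in Σ_{2k} if and only if it is in Σ_{2k-1}. -/
/-!
Distributed decision in the LOCAL model: configurations, local algorithms,
the local hierarchy Σ_k / Π_k / Λ_k and co-Λ_k.
-/

/-- A configuration: a finite connected simple graph on `Fin n` (with `n ≥ 1`)
together with an input bit string at each node. -/
structure Config where
  n : ℕ
  npos : 0 < n
  G : SimpleGraph (Fin n)
  conn : G.Connected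
  x : Fin n → List Bool

/-- The ball of radius `t` around `v`: all nodes at distance at most `t`. -/
def ball (C : Config) (v : Fin C.n) (t : ℕ) : Set (Fin C.n) :=
  {u | C.G.dist v u ≤ t}

lemma self_mem_ball (C : Config) (v : Fin C.n) (t : ℕ) : v ∈ ball C v t := by
  simp [ball, SimpleGraph.dist_self]

/-- A `t`-round local algorithm: at each node it outputs a bit, computed from the whole
configuration, identity assignment and labellings, subject to locality: the output at `v`
only depends on the ball of radius `t` around `v` together with the inputs, identities and
labellings on it (isomorphic labelled balls give equal outputs). -/
structure LocalAlg where
  t : ℕ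
  run : (C : Config) → (Fin C.n → ℕ) → (ℕ → Fin C.n → List Bool) → Fin C.n → Bool
  isLocal : ∀ (C C' : Config) (ident : Fin C.n → ℕ) (ident' : Fin C'.n → ℕ)
      (ℓ : ℕ → Fin C.n → List Bool) (ℓ' : ℕ → Fin C'.n → List Bool)
      (v : Fin C.n) (v' : Fin C'.n)
      (φ : (C.G.induce (ball C v t)) ≃g (C'.G.induce (ball C' v' t))),
      ((φ ⟨v, self_mem_ball C v t⟩).val = v') →
      (∀ u : ball C v t, C'.x (φ u).val = C.x u.val) →
      (∀ u : ball C v t, ident' (φ u).val = ident u.val) →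
      (∀ (i : ℕ) (u : ball C v t), ℓ' i (φ u).val = ℓ i u.val) →
      run C ident ℓ v = run C' ident' ℓ' v'

/-- A labelling of size `c · log₂ n`. -/
def goodLabel (c : ℕ) (C : Config) (ℓ : Fin C.n → List Bool) : Prop :=
  ∀ v, (ℓ v).length ≤ c * Nat.log 2 C.n

/-- Alternating quantification over `j` further labellings (stored at indices `i, i+1, …`),
starting with an existential quantifier when the `Bool` argument is `true` and with a
universal quantifier when it is `false`; `P` is the final predicate. -/
def altQ (c : ℕ) (C : Config) (P : (ℕ → Fin C.n → List Bool) → Prop) :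
    ℕ → ℕ → Bool → (ℕ → Fin C.n → List Bool) → Prop
  | 0, _, _, ℓs => P ℓs
  | j + 1, i, true, ℓs =>
      ∃ ℓ, goodLabel c C ℓ ∧ altQ c C P j (i + 1) false (Function.update ℓs i ℓ)
  | j + 1, i, false, ℓs =>
      ∀ ℓ, goodLabel c C ℓ → altQ c C P j (i + 1) true (Function.update ℓs i ℓ)

/-- Global acceptance: every node outputs 1. -/
def accepts (A : LocalAlg) (C : Config) (ident : Fin C.n → ℕ)
    (ℓs : ℕ → Fin C.n → List Bool) : Prop :=
  ∀ v, A.run C ident ℓs v = true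

/-- The empty collection of labellings. -/
def noLabels (C : Config) : ℕ → Fin C.n → List Bool := fun _ _ => []

/-- Inputs are bounded by `α · log₂ n` bits. -/
def BoundedInput (α : ℕ) (C : Config) : Prop :=
  ∀ v, (C.x v).length ≤ α * Nat.log 2 C.n

/-- An identity assignment: injective, with values in `{1, …, n^β}`. -/
def IsIdAssignment (β : ℕ) (C : Config) (ident : Fin C.n → ℕ) : Prop :=
  Function.Injective ident ∧ ∀ v, 1 ≤ ident v ∧ ident v ≤ C.n ^ β

/-- The class `Σ_k` (with input-size constant `α` and identity-space constant `β`):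
`(G,x) ∈ L ⟺ ∃ℓ₁ ∀ℓ₂ … Q ℓ_k`, `A` accepts, for every identity assignment. -/
def SigmaC (α β k : ℕ) (L : Set Config) : Prop :=
  ∃ (A : LocalAlg) (c : ℕ), ∀ C : Config, BoundedInput α C →
    ∀ ident : Fin C.n → ℕ, IsIdAssignment β C ident →
      (C ∈ L ↔ altQ c C (accepts A C ident) k 0 true (noLabels C))

/-- The class `Π_k`: as `Σ_k` but the alternation starts with a universal quantifier. -/
def PiC (α β k : ℕ) (L : Set Config) : Prop :=
  ∃ (A : LocalAlg) (c : ℕ), ∀ C : Config, BoundedInput α C →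
    ∀ ident : Fin C.n → ℕ, IsIdAssignment β C ident →
      (C ∈ L ↔ altQ c C (accepts A C ident) k 0 false (noLabels C))

/-- `Λ_k := Σ_k` for odd `k`, `Λ_k := Π_k` for even `k` (so `Λ_0 = LD`). -/
def LambdaC (α β k : ℕ) (L : Set Config) : Prop :=
  if k % 2 = 1 then SigmaC α β k L else PiC α β k L

/-- `co-Λ_k`: the complement (within the set of all configurations) is in `Λ_k`. -/
def coLambdaC (α β k : ℕ) (L : Set Config) : Prop :=
  LambdaC α β k ({C : Config | BoundedInput α C} \ L)

/-- Input-preserving isomorphism of configurations. -/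
def ConfigIso (C C' : Config) : Prop :=
  ∃ φ : C.G ≃g C'.G, ∀ v, C'.x (φ v) = C.x v

/-- A distributed language: a set of configurations (with bounded inputs)
closed under input-preserving isomorphism. -/
def IsDistLang (α : ℕ) (L : Set Config) : Prop :=
  (∀ C ∈ L, BoundedInput α C) ∧ ∀ C C', ConfigIso C C' → (C ∈ L ↔ C' ∈ L)

/-- The leading quantifier of `Λ_k`: existential iff `k` is odd. -/
def startEx (k : ℕ) : Bool := decide (k % 2 = 1)

section Encoding

/-- Split off the first self-delimiting block of a bit string. -/
def splitWord : List Bool → List Bool × List Bool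
  | true :: b :: w => (b :: (splitWord w).1, (splitWord w).2)
  | false :: w => ([], w)
  | _ => ([], [])

/-- Self-delimiting encoding of a bit string. -/
def delimit : List Bool → List Bool
  | [] => [false]
  | b :: w => true :: b :: delimit w

lemma splitWord_delimit (w z : List Bool) : splitWord (delimit w ++ z) = (w, z) := by
  induction w with
  | nil => simp [delimit, splitWord]
  | cons b w ih => simp [delimit, splitWord, ih]

lemma length_delimit (w : List Bool) : (delimit w).length = 2 * w.length + 1 := by
  induction w with
  | nil => simp [delimit]
  | cons b w ih => simp [delimit, ih]; ring

/-- The natural number with the given binary digits, least significant first. -/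
def readNat (w : List Bool) : ℕ := w.foldr Nat.bit 0

lemma readNat_bits (n : ℕ) : readNat n.bits = n := by
  induction n using Nat.binaryRec' with
  | zero => simp [readNat]
  | bit b n h ih =>
    rw [Nat.bits_append_bit n b h]
    exact congrArg (Nat.bit b) ih

/-- The positive number encoded by the first block of a bit string. -/
def headNum (w : List Bool) : ℕ := readNat (splitWord w).1 + 1

/-- What remains of a bit string after its first block. -/
def restWord (w : List Bool) : List Bool := (splitWord w).2

/-- The claimed identity of the root. -/
def rootOf (w : List Bool) : ℕ := headNum w

/-- The claimed identity of the parent. -/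
def parentOf (w : List Bool) : ℕ := headNum (restWord w)

/-- The claimed number of nodes of the subtree. -/
def sizeOfSubtree (w : List Bool) : ℕ := headNum (restWord (restWord w))

/-- The claimed number of nodes of the graph. -/
def totalOf (w : List Bool) : ℕ := headNum (restWord (restWord (restWord w)))

/-- The label carried next to the counting certificate. -/
def payload (w : List Bool) : List Bool := restWord (restWord (restWord (restWord w)))

lemma headNum_delimit {a : ℕ} (ha : 1 ≤ a) (z : List Bool) :
    headNum (delimit (a - 1).bits ++ z) = a := by
  simp [headNum, splitWord_delimit, readNat_bits, Nat.sub_add_cancel ha]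

lemma restWord_delimit (w z : List Bool) : restWord (delimit w ++ z) = z := by
  simp [restWord, splitWord_delimit]

lemma length_delimit_bits_le {n β a : ℕ} (hn : 2 ≤ n) (ha : 1 ≤ a ∧ a ≤ n ^ β) :
    (delimit (a - 1).bits).length ≤ (4 * β + 1) * Nat.log 2 n := by
  have hlog : 1 ≤ Nat.log 2 n := Nat.log_pos (by norm_num) hn
  have hsize : (a - 1).size ≤ (Nat.log 2 n + 1) * β := by
    rw [Nat.size_le]
    calc a - 1 < n ^ β := by omega
      _ ≤ (2 ^ (Nat.log 2 n + 1)) ^ β :=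
        Nat.pow_le_pow_left (Nat.lt_pow_succ_log_self (by norm_num) n).le β
      _ = 2 ^ ((Nat.log 2 n + 1) * β) := (pow_mul _ _ _).symm
  rw [length_delimit, Nat.size_eq_bits_len]
  nlinarith

/-- Four numbers in `{1, …, n^β}` and a short bit string fit into one label. -/
lemma exists_encoding {n β c r p s N : ℕ} {w : List Bool} (hn : 0 < n)
    (hr : 1 ≤ r ∧ r ≤ n ^ β) (hp : 1 ≤ p ∧ p ≤ n ^ β) (hs : 1 ≤ s ∧ s ≤ n ^ β)
    (hN : 1 ≤ N ∧ N ≤ n ^ β) (hw : w.length ≤ c * Nat.log 2 n) :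
    ∃ z : List Bool, z.length ≤ (4 * (4 * β + 1) + c) * Nat.log 2 n ∧ rootOf z = r ∧
      parentOf z = p ∧ sizeOfSubtree z = s ∧ totalOf z = N ∧ payload z = w := by
  rcases Nat.lt_or_ge n 2 with h | h
  · obtain rfl : n = 1 := by omega
    simp only [one_pow] at hr hp hs hN
    have hw' : w = [] := by simpa using hw
    refine ⟨[], by simp, ?_⟩
    simp [rootOf, parentOf, sizeOfSubtree, totalOf, payload, headNum, restWord, splitWord,
      readNat, hw']
    omega
  · refine ⟨delimit (r - 1).bits ++ (delimit (p - 1).bits ++ (delimit (s - 1).bits ++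
      (delimit (N - 1).bits ++ w))), ?_, ?_⟩
    · have h₁ := length_delimit_bits_le h hr
      have h₂ := length_delimit_bits_le h hp
      have h₃ := length_delimit_bits_le h hs
      have h₄ := length_delimit_bits_le h hN
      simp only [List.length_append]
      linarith
    · simp [rootOf, parentOf, sizeOfSubtree, totalOf, payload, restWord_delimit,
        headNum_delimit, hr.1, hp.1, hs.1, hN.1]

end Encoding

section Counting

variable {V : Type*} {G : SimpleGraph V}

open Classical in
/-- The local conditions, at node `v`, of a certificate that the graph has `N` nodes: `r` is the
identity of the root of a spanning tree, `p` the identity of the parent and `s` the number of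
nodes of the subtree. -/
def CountsAt [Fintype V] (G : SimpleGraph V) (ident r p s N : V → ℕ) (v : V) : Prop :=
  (∀ u, G.Adj v u → r u = r v ∧ N u = N v) ∧
  (ident v = r v → s v = N v) ∧
  (ident v ≠ r v → ∃ u, G.Adj v u ∧ ident u = p v) ∧
  s v = 1 + ∑ u, if G.Adj v u ∧ p u = ident v ∧ ident u ≠ r v then s u else 0

lemma eq_of_forall_adj {α : Type*} (hG : G.Connected) {f : V → α}
    (h : ∀ v u, G.Adj v u → f u = f v) (v u : V) : f u = f v := by
  obtain ⟨w⟩ := hG.preconnected v u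
  induction w with
  | nil => rfl
  | cons hadj _ ih => exact ih.trans (h _ _ hadj)

theorem eq_card_of_countsAt [Fintype V] (hG : G.Connected) {ident r p s N : V → ℕ}
    (hid : Function.Injective ident) (h : ∀ v, CountsAt G ident r p s N v) (v : V) :
    N v = Fintype.card V := by
  classical
  have hr : ∀ u, r u = r v := eq_of_forall_adj hG (fun v u huv => ((h v).1 u huv).1) v
  have hN : ∀ u, N u = N v := eq_of_forall_adj hG (fun v u huv => ((h v).1 u huv).2) v
  have hone : ∀ u, (∑ w, if G.Adj w u ∧ p u = ident w ∧ ident u ≠ r w then s u else 0)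
      = if ident u ≠ r v then s u else 0 := by
    intro u
    by_cases hu : ident u = r v
    · simp [hr, hu]
    · obtain ⟨w, huw, hw⟩ := (h u).2.2.1 (by rwa [hr])
      rw [Finset.sum_eq_single w]
      · simp [huw.symm, hw, hr]
      · intro x _ hx
        rw [if_neg]
        rintro ⟨-, h', -⟩
        exact hx (hid (h'.symm.trans hw.symm))
      · simp
  have hsum : ∑ u, s u = Fintype.card V + ∑ u, if ident u ≠ r v then s u else 0 := by
    calc ∑ w, s w = ∑ w, (1 + ∑ u, if G.Adj w u ∧ p u = ident w ∧ ident u ≠ r w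
          then s u else 0) := Finset.sum_congr rfl fun w _ => (h w).2.2.2
      _ = _ := by
        rw [Finset.sum_add_distrib, Finset.sum_comm, Finset.sum_congr rfl fun u _ => hone u]
        simp
  have hroot : ∑ u, (if ident u = r v then s u else 0) = Fintype.card V := by
    have hsplit : ∑ u, s u = ∑ u, (if ident u = r v then s u else 0) +
        ∑ u, if ident u ≠ r v then s u else 0 := by
      rw [← Finset.sum_add_distrib]
      refine Finset.sum_congr rfl fun u _ => ?_
      by_cases hu : ident u = r v <;> simp [hu]
    omega
  have hpos : 0 < Fintype.card V := Fintype.card_pos_iff.2 ⟨v⟩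
  obtain ⟨u, -, hu⟩ : ∃ u ∈ Finset.univ, (if ident u = r v then s u else 0) ≠ 0 :=
    Finset.exists_ne_zero_of_sum_ne_zero (by omega)
  have hur : ident u = r v := by
    by_contra hne
    simp [hne] at hu
  rw [Finset.sum_eq_single u, if_pos hur, (h u).2.1 (by rw [hr, hur]), hN] at hroot
  · exact hroot
  · intro x _ hx
    rw [if_neg]
    exact fun h' => hx (hid (h'.trans hur.symm))
  · simp

lemma exists_adj_dist_add_one (hG : G.Connected) {v u : V} (h : v ≠ u) :
    ∃ w, G.Adj u w ∧ G.dist v w + 1 = G.dist v u := by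
  obtain ⟨p, hp⟩ := hG.exists_walk_length_eq_dist u v
  cases p with
  | nil => exact absurd rfl h
  | @cons _ w _ hadj p =>
    refine ⟨w, hadj, ?_⟩
    have h₁ : G.dist w v ≤ p.length := SimpleGraph.dist_le p
    have h₂ : G.dist u v ≤ G.dist u w + G.dist w v := hG.dist_triangle
    rw [SimpleGraph.dist_eq_one_iff_adj.2 hadj] at h₂
    rw [SimpleGraph.Walk.length_cons] at hp
    rw [SimpleGraph.dist_comm (u := v), SimpleGraph.dist_comm (u := v)]
    omega

/-- The subtree sizes of a rooted forest given by a parent function `f` and a depth function `d`. -/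
theorem exists_subtree_size [Fintype V] [DecidableEq V] (f : V → V) (d : V → ℕ)
    (hf : ∀ v, d v ≠ 0 → d (f v) + 1 = d v) :
    ∃ D : V → Finset V, (∀ v, v ∈ D v) ∧
      (∀ v w, w ∈ D v ↔ d v ≤ d w ∧ f^[d w - d v] w = v) ∧
      ∀ v, (D v).card = 1 + ∑ u with f u = v ∧ d u ≠ 0, (D u).card := by
  let D : V → Finset V := fun v => {w | d v ≤ d w ∧ f^[d w - d v] w = v}
  have hD : ∀ v w, w ∈ D v ↔ d v ≤ d w ∧ f^[d w - d v] w = v := by simp [D]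
  have hself : ∀ v, v ∈ D v := by simp [D]
  have hiter : ∀ k w, k ≤ d w → d (f^[k] w) = d w - k := by
    intro k
    induction k with
    | zero => simp
    | succ k ih =>
      intro w hk
      have := hf (f^[k] w) (by rw [ih w (by omega)]; omega)
      rw [ih w (by omega)] at this
      rw [Function.iterate_succ_apply']
      omega
  have hlt : ∀ u, d u ≠ 0 → ∀ w ∈ D u, d (f u) < d w := by
    intro u hu w hw
    have := hf u hu
    have := ((hD _ _).1 hw).1
    omega
  refine ⟨D, hself, hD, fun v => ?_⟩
  have hdisj : ((Finset.univ.filter fun u => f u = v ∧ d u ≠ 0 : Finset V) :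
      Set V).PairwiseDisjoint D := by
    intro u hu u' hu' hne
    simp only [Finset.coe_filter, Finset.mem_univ, true_and, Set.mem_ofPred_eq] at hu hu'
    refine Finset.disjoint_left.2 fun w hw hw' => hne ?_
    have h₁ := hf u hu.2
    have h₂ := hf u' hu'.2
    rw [hu.1] at h₁
    rw [hu'.1] at h₂
    rw [← ((hD _ _).1 hw).2, ← ((hD _ _).1 hw').2, ← h₁, ← h₂]
  have hnot : v ∉ (Finset.univ.filter fun u => f u = v ∧ d u ≠ 0).biUnion D := by
    simp only [Finset.mem_biUnion, Finset.mem_filter, Finset.mem_univ, true_and, not_exists,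
      not_and, and_imp]
    rintro u rfl hu hw
    exact lt_irrefl _ (hlt u hu _ hw)
  have hDv : D v = insert v ((Finset.univ.filter fun u => f u = v ∧ d u ≠ 0).biUnion D) := by
    ext w
    simp only [Finset.mem_insert, Finset.mem_biUnion, Finset.mem_filter, Finset.mem_univ, true_and]
    constructor
    · intro hw
      obtain ⟨hle, hw⟩ := (hD _ _).1 hw
      rcases hle.eq_or_lt with heq | hlt
      · left
        simpa [heq] using hw
      · right
        have hdu : d (f^[d w - d v - 1] w) = d v + 1 := by
          rw [hiter _ _ (by omega)]
          omega
        refine ⟨f^[d w - d v - 1] w, ⟨?_, by omega⟩, ?_⟩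
        · rw [← Function.iterate_succ_apply' f, Nat.succ_eq_add_one,
            Nat.sub_add_cancel (by omega), hw]
        · rw [hD, hdu]
          exact ⟨hlt, by rw [Nat.sub_sub]⟩
    · rintro (rfl | ⟨u, ⟨rfl, hu⟩, hw⟩)
      · exact hself _
      · have h₁ := hf u hu
        obtain ⟨h₂, h₃⟩ := (hD _ _).1 hw
        rw [hD]
        refine ⟨by omega, ?_⟩
        rw [show d w - d (f u) = (d w - d u) + 1 by omega, Function.iterate_succ_apply', h₃]
  rw [hDv, Finset.card_insert_of_notMem hnot, Finset.card_biUnion hdisj, add_comm]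

theorem exists_countsAt [Fintype V] (hG : G.Connected) {ident : V → ℕ}
    (hid : Function.Injective ident) :
    ∃ (v₀ : V) (f : V → V) (s : V → ℕ), (∀ v, 1 ≤ s v ∧ s v ≤ Fintype.card V) ∧
      ∀ v, CountsAt G ident (fun _ => ident v₀) (fun u => ident (f u)) s
        (fun _ => Fintype.card V) v := by
  classical
  obtain ⟨v₀⟩ := hG.nonempty
  have hex : ∀ u, ∃ w, (v₀ = u → w = v₀) ∧
      (v₀ ≠ u → G.Adj u w ∧ G.dist v₀ w + 1 = G.dist v₀ u) := by
    intro u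
    by_cases hu : v₀ = u
    · exact ⟨v₀, by simp [hu]⟩
    · obtain ⟨w, hw⟩ := exists_adj_dist_add_one hG hu
      exact ⟨w, fun h => absurd h hu, fun _ => hw⟩
  choose f hf₀ hf using hex
  have hd : ∀ u, G.dist v₀ u ≠ 0 ↔ v₀ ≠ u := fun u => not_congr hG.dist_eq_zero_iff
  obtain ⟨D, hself, hD, hcard⟩ :=
    exists_subtree_size f (G.dist v₀) fun u hu => (hf u ((hd u).1 hu)).2
  refine ⟨v₀, f, fun v => (D v).card, fun v => ⟨Finset.card_pos.2 ⟨v, hself v⟩,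
    Finset.card_le_univ _⟩, fun v => ⟨fun _ _ => ⟨rfl, rfl⟩, ?_, ?_, ?_⟩⟩
  · intro hv
    obtain rfl := hid hv
    have huniv : D v = Finset.univ := by
      refine Finset.eq_univ_of_forall fun w => (hD _ _).2 ?_
      simp only [SimpleGraph.dist_self, Nat.zero_le, true_and, Nat.sub_zero]
      generalize hk : G.dist v w = k
      induction k generalizing w with
      | zero => simpa using (hG.dist_eq_zero_iff.1 hk).symm
      | succ k ih =>
        have := (hf w ((hd w).1 (by omega))).2
        rw [Function.iterate_succ_apply]
        exact ih _ (by omega)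
    simp [huniv]
  · intro hv
    exact ⟨f v, (hf v fun h => hv (by rw [h])).1, rfl⟩
  · change (D v).card = _
    rw [hcard v, Finset.sum_filter]
    refine congrArg (1 + ·) (Finset.sum_congr rfl fun u _ => if_congr ?_ rfl rfl)
    rw [hid.eq_iff, hid.ne_iff, hd]
    constructor
    · rintro ⟨rfl, hu⟩
      exact ⟨(hf u hu).1.symm, rfl, hu.symm⟩
    · rintro ⟨-, hu, hne⟩
      exact ⟨hu, hne.symm⟩

end Counting

section Locality

/-- The views of radius `T` of `v` in `C` and of `v'` in `C'` are isomorphic through `φ`. -/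
structure SameView (T : ℕ) (C C' : Config) (ident : Fin C.n → ℕ) (ident' : Fin C'.n → ℕ)
    (ℓ : ℕ → Fin C.n → List Bool) (ℓ' : ℕ → Fin C'.n → List Bool) (v : Fin C.n) (v' : Fin C'.n)
    (φ : (C.G.induce (ball C v T)) ≃g (C'.G.induce (ball C' v' T))) : Prop where
  center : φ ⟨v, self_mem_ball C v T⟩ = ⟨v', self_mem_ball C' v' T⟩
  input : ∀ u : ball C v T, C'.x (φ u).val = C.x u.val
  identity : ∀ u : ball C v T, ident' (φ u).val = ident u.val
  label : ∀ (i : ℕ) (u : ball C v T), ℓ' i (φ u).val = ℓ i u.val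

variable {T : ℕ} {C C' : Config} {ident : Fin C.n → ℕ} {ident' : Fin C'.n → ℕ}
  {ℓ : ℕ → Fin C.n → List Bool} {ℓ' : ℕ → Fin C'.n → List Bool} {v : Fin C.n} {v' : Fin C'.n}
  {φ : (C.G.induce (ball C v T)) ≃g (C'.G.induce (ball C' v' T))}

namespace SameView

lemma symm (h : SameView T C C' ident ident' ℓ ℓ' v v' φ) :
    SameView T C' C ident' ident ℓ' ℓ v' v φ.symm where
  center := by rw [← h.center, RelIso.symm_apply_apply]
  input u := by simpa using (h.input (φ.symm u)).symm
  identity u := by simpa using (h.identity (φ.symm u)).symm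
  label i u := by simpa using (h.label i (φ.symm u)).symm

lemma adj_iff (h : SameView T C C' ident ident' ℓ ℓ' v v' φ) (u : ball C v T) :
    C'.G.Adj v' (φ u).val ↔ C.G.Adj v u.val := by
  have := φ.map_rel_iff (a := ⟨v, self_mem_ball C v T⟩) (b := u)
  rw [h.center] at this
  exact this

lemma identity_center (h : SameView T C C' ident ident' ℓ ℓ' v v' φ) : ident' v' = ident v := by
  have := h.identity ⟨v, self_mem_ball C v T⟩
  rwa [h.center] at this

lemma label_center (h : SameView T C C' ident ident' ℓ ℓ' v v' φ) (i : ℕ) : ℓ' i v' = ℓ i v := by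
  have := h.label i ⟨v, self_mem_ball C v T⟩
  rwa [h.center] at this

lemma dist_le (h : SameView T C C' ident ident' ℓ ℓ' v v' φ) (u : ball C v T) :
    C'.G.dist v' (φ u).val ≤ C.G.dist v u.val := by
  generalize hk : C.G.dist v u.val = k
  induction k generalizing u with
  | zero =>
    have hu : u = ⟨v, self_mem_ball C v T⟩ := Subtype.ext (C.conn.dist_eq_zero_iff.1 hk).symm
    rw [hu, h.center]
    simp
  | succ k ih =>
    have hne : v ≠ u.val := by
      intro hv
      rw [← hv, SimpleGraph.dist_self] at hk
      omega
    obtain ⟨w, hw, hd⟩ := exists_adj_dist_add_one C.conn hne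
    have hu : C.G.dist v u.val ≤ T := u.2
    have hwT : w ∈ ball C v T := by
      change C.G.dist v w ≤ T
      omega
    have h₁ := ih ⟨w, hwT⟩ (by change C.G.dist v w = k; omega)
    have hadj : C'.G.Adj (φ ⟨w, hwT⟩).val (φ u).val :=
      φ.map_rel_iff.2 (show C.G.Adj w u.val from hw.symm)
    have h₂ : C'.G.dist v' (φ u).val ≤
        C'.G.dist v' (φ ⟨w, hwT⟩).val + C'.G.dist (φ ⟨w, hwT⟩).val (φ u).val :=
      C'.conn.dist_triangle
    rw [SimpleGraph.dist_eq_one_iff_adj.2 hadj] at h₂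
    omega

lemma exists_restrict (h : SameView T C C' ident ident' ℓ ℓ' v v' φ) {t : ℕ} (htT : t ≤ T) :
    ∃ ψ : (C.G.induce (ball C v t)) ≃g (C'.G.induce (ball C' v' t)),
      ∀ u : ball C v t, (ψ u).val = (φ ⟨u.val, le_trans u.2 htT⟩).val := by
  refine ⟨{ toFun := fun u => ⟨(φ ⟨u.val, le_trans u.2 htT⟩).val, (h.dist_le _).trans u.2⟩
            invFun := fun u =>
              ⟨(φ.symm ⟨u.val, le_trans u.2 htT⟩).val, (h.symm.dist_le _).trans u.2⟩
            left_inv := fun u => by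
              have := congrArg Subtype.val (φ.symm_apply_apply ⟨u.val, le_trans u.2 htT⟩)
              exact Subtype.ext this
            right_inv := fun u => by
              have := congrArg Subtype.val (φ.apply_symm_apply ⟨u.val, le_trans u.2 htT⟩)
              exact Subtype.ext this
            map_rel_iff' := ?_ }, fun u => rfl⟩
  intro a b
  exact φ.map_rel_iff (a := ⟨a.val, le_trans a.2 htT⟩) (b := ⟨b.val, le_trans b.2 htT⟩)

end SameView

open Classical in
/-- The counting conditions `CountsAt` at `v`, read off the ball of radius `T` around `v`. -/
def CountsInBall (T : ℕ) (C : Config) (ident : Fin C.n → ℕ) (m : Fin C.n → List Bool)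
    (v : Fin C.n) : Prop :=
  (∀ u : ball C v T, C.G.Adj v u.val →
    rootOf (m u.val) = rootOf (m v) ∧ totalOf (m u.val) = totalOf (m v)) ∧
  (ident v = rootOf (m v) → sizeOfSubtree (m v) = totalOf (m v)) ∧
  (ident v ≠ rootOf (m v) →
    ∃ u : ball C v T, C.G.Adj v u.val ∧ ident u.val = parentOf (m v)) ∧
  sizeOfSubtree (m v) = 1 + ∑ u : ball C v T,
    if C.G.Adj v u.val ∧ parentOf (m u.val) = ident v ∧ ident u.val ≠ rootOf (m v)
    then sizeOfSubtree (m u.val) else 0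

lemma mem_ball_of_adj (hT : 1 ≤ T) {u : Fin C.n} (h : C.G.Adj v u) : u ∈ ball C v T := by
  change C.G.dist v u ≤ T
  rwa [SimpleGraph.dist_eq_one_iff_adj.2 h]

lemma countsInBall_iff (hT : 1 ≤ T) (m : Fin C.n → List Bool) :
    CountsInBall T C ident m v ↔ CountsAt C.G ident (fun u => rootOf (m u))
      (fun u => parentOf (m u)) (fun u => sizeOfSubtree (m u)) (fun u => totalOf (m u)) v := by
  classical
  unfold CountsInBall CountsAt
  refine and_congr ?_ (and_congr Iff.rfl (and_congr (imp_congr Iff.rfl ?_) ?_))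
  · exact ⟨fun h u hu => h ⟨u, mem_ball_of_adj hT hu⟩ hu, fun h u hu => h u.val hu⟩
  · exact ⟨fun ⟨u, hu⟩ => ⟨u.val, hu⟩, fun ⟨u, hu⟩ => ⟨⟨u, mem_ball_of_adj hT hu.1⟩, hu⟩⟩
  · rw [Fintype.sum_of_injective (Subtype.val : ball C v T → Fin C.n) Subtype.val_injective _
      (fun u => if C.G.Adj v u ∧ parentOf (m u) = ident v ∧ ident u ≠ rootOf (m v)
        then sizeOfSubtree (m u) else 0) ?_ fun _ => rfl]
    intro u hu
    rw [if_neg]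
    exact fun h => hu ⟨⟨u, mem_ball_of_adj hT h.1⟩, rfl⟩

lemma SameView.countsInBall (h : SameView T C C' ident ident' ℓ ℓ' v v' φ) {q : ℕ}
    (hc : CountsInBall T C ident (ℓ q) v) : CountsInBall T C' ident' (ℓ' q) v' := by
  classical
  obtain ⟨h₁, h₂, h₃, h₄⟩ := hc
  unfold CountsInBall
  rw [h.label_center, h.identity_center]
  refine ⟨fun u => ?_, h₂, fun hne => ?_, h₄.trans (congrArg (1 + ·) ?_)⟩
  · obtain ⟨w, rfl⟩ := φ.surjective u
    rw [h.adj_iff, h.label]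
    exact h₁ w
  · obtain ⟨w, hw⟩ := h₃ hne
    refine ⟨φ w, ?_⟩
    rwa [h.adj_iff, h.identity]
  · refine Fintype.sum_equiv φ.toEquiv _ _ fun u => ?_
    change _ = if C'.G.Adj v' (φ u).val ∧ parentOf (ℓ' q (φ u).val) = ident v ∧
      ident' (φ u).val ≠ rootOf (ℓ q v) then sizeOfSubtree (ℓ' q (φ u).val) else 0
    simp only [h.adj_iff, h.identity, h.label]

/-- Truncate all labels to `b` bits, replace the label `q` by its payload, and use `m` as the
label `q + 1`. -/
def truncLabels {V : Type*} (b q : ℕ) (ℓ : ℕ → V → List Bool) (m : V → List Bool) :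
    ℕ → V → List Bool := fun i u =>
  if i = q + 1 then m u else if i = q then (payload (ℓ q u)).take b else (ℓ i u).take b

/-- The number of bits a node allows for a label, according to its counting certificate. -/
def claimedBound (c : ℕ) (w : List Bool) : ℕ := c * Nat.log 2 (totalOf w)

/-- The node verifies the counting certificate in the label `q`, and runs `A` with every possible
label `q + 1` that respects the size bound. -/
def CollapseAccepts (A : LocalAlg) (c q : ℕ) (C : Config) (ident : Fin C.n → ℕ)
    (ℓ : ℕ → Fin C.n → List Bool) (v : Fin C.n) : Prop :=
  CountsInBall (A.t + 1) C ident (ℓ q) v ∧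
    ∀ m : Fin C.n → List Bool, (∀ u, (m u).length ≤ claimedBound c (ℓ q v)) →
      A.run C ident (truncLabels (claimedBound c (ℓ q v)) q ℓ m) v = true

lemma SameView.collapseAccepts {A : LocalAlg} {c q : ℕ}
    {φ : (C.G.induce (ball C v (A.t + 1))) ≃g (C'.G.induce (ball C' v' (A.t + 1)))}
    (h : SameView (A.t + 1) C C' ident ident' ℓ ℓ' v v' φ)
    (hc : CollapseAccepts A c q C ident ℓ v) : CollapseAccepts A c q C' ident' ℓ' v' := by
  classical
  refine ⟨h.countsInBall hc.1, fun m' hm' => ?_⟩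
  rw [h.label_center] at hm' ⊢
  obtain ⟨ψ, hψ⟩ := h.exists_restrict (Nat.le_succ A.t)
  let m : Fin C.n → List Bool := fun u =>
    if hu : u ∈ ball C v (A.t + 1) then m' (φ ⟨u, hu⟩).val else []
  have hm : ∀ u : ball C v (A.t + 1), m' (φ u).val = m u.val := fun u => by simp [m]
  rw [← hc.2 m fun u => ?_]
  · symm
    refine A.isLocal C C' ident ident' _ _ v v' ψ ?_ ?_ ?_ ?_
    · rw [hψ, h.center]
    · intro u
      rw [hψ, h.input]
    · intro u
      rw [hψ, h.identity]
    · intro i u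
      simp only [truncLabels, hψ, h.label, hm]
  · by_cases hu : u ∈ ball C v (A.t + 1)
    · simpa [m, hu] using hm' _
    · simp [m, hu]

open Classical in
/-- The algorithm that replaces the last universal label of `A` by a counting certificate. -/
noncomputable def collapseAlg (A : LocalAlg) (c q : ℕ) : LocalAlg where
  t := A.t + 1
  run C ident ℓ v := decide (CollapseAccepts A c q C ident ℓ v)
  isLocal C C' ident ident' ℓ ℓ' v v' φ h₁ h₂ h₃ h₄ := by
    have h : SameView (A.t + 1) C C' ident ident' ℓ ℓ' v v' φ := ⟨Subtype.ext h₁, h₂, h₃, h₄⟩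
    exact decide_eq_decide.2 ⟨h.collapseAccepts, h.symm.collapseAccepts⟩

/-- The algorithm that runs `A` with the label `q` erased. -/
def eraseAlg (A : LocalAlg) (q : ℕ) : LocalAlg where
  t := A.t
  run C ident ℓ v := A.run C ident (Function.update ℓ q fun _ => []) v
  isLocal C C' ident ident' ℓ ℓ' v v' φ h₁ h₂ h₃ h₄ := by
    refine A.isLocal C C' ident ident' _ _ v v' φ h₁ h₂ h₃ fun i u => ?_
    by_cases hi : i = q
    · subst hi
      simp
    · simp [hi, h₄]

end Locality

section Quantifiers

variable {C : Config} {P P' : (ℕ → Fin C.n → List Bool) → Prop}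

lemma goodLabel_nil (c : ℕ) (C : Config) : goodLabel c C fun _ => [] := fun _ => by simp

lemma altQ_iff_altQ_succ {c K : ℕ} (hP : ∀ ℓ, P' ℓ ↔ P (Function.update ℓ K fun _ => []))
    (j i : ℕ) (b : Bool) (ℓ : ℕ → Fin C.n → List Bool) (hij : i + j = K)
    (hℓ : ℓ K = fun _ => []) :
    altQ c C P j i b ℓ ↔ altQ c C P' (j + 1) i b ℓ := by
  induction j generalizing i b ℓ with
  | zero =>
    obtain rfl : i = K := by omega
    have key : ∀ m, P' (Function.update ℓ i m) ↔ P ℓ := fun m => by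
      rw [hP, Function.update_idem, ← hℓ, Function.update_eq_self]
    cases b
    · simp only [altQ, key]
      exact ⟨fun h _ _ => h, fun h => h _ (goodLabel_nil c C)⟩
    · simp only [altQ, key]
      exact ⟨fun h => ⟨_, goodLabel_nil c C, h⟩, fun ⟨_, _, h⟩ => h⟩
  | succ j ih =>
    have key := fun b m => ih (i + 1) b (Function.update ℓ i m) (by omega)
      (by rw [Function.update_of_ne (by omega), hℓ])
    cases b
    · exact forall_congr' fun m => imp_congr Iff.rfl (key true m)
    · exact exists_congr fun m => and_congr Iff.rfl (key false m)

/-- Quantifying over labels of a larger size and truncating them is the same as quantifying over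
labels of the smaller size. -/
lemma altQ_iff_altQ_of_truncate {c c' q : ℕ} (hc : c ≤ c')
    (hbase : ∀ ℓ ℓ' : ℕ → Fin C.n → List Bool,
      (∀ i u, ℓ i u = (ℓ' i u).take (c * Nat.log 2 C.n)) →
      (altQ c C P 2 q true ℓ ↔ altQ c' C P' 1 q true ℓ'))
    (j i : ℕ) (b : Bool) (hb : b = !j.bodd) (ℓ ℓ' : ℕ → Fin C.n → List Bool) (hij : i + j = q)
    (hℓ : ∀ i u, ℓ i u = (ℓ' i u).take (c * Nat.log 2 C.n)) :
    altQ c C P (j + 2) i b ℓ ↔ altQ c' C P' (j + 1) i b ℓ' := by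
  induction j generalizing i b ℓ ℓ' with
  | zero =>
    obtain rfl : i = q := by omega
    obtain rfl : b = true := by simpa using hb
    exact hbase ℓ ℓ' hℓ
  | succ j ih =>
    have key : ∀ m m' : Fin C.n → List Bool, (∀ u, m u = (m' u).take (c * Nat.log 2 C.n)) →
        (altQ c C P (j + 2) (i + 1) (!b) (Function.update ℓ i m) ↔
          altQ c' C P' (j + 1) (i + 1) (!b) (Function.update ℓ' i m')) := by
      intro m m' hm
      refine ih (i + 1) (!b) (by simp [hb]) _ _ (by omega) fun k u => ?_
      by_cases hk : k = i
      · subst hk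
        simpa using hm u
      · simpa [hk] using hℓ k u
    have hself : ∀ m, goodLabel c C m → ∀ u, m u = (m u).take (c * Nat.log 2 C.n) :=
      fun m hm u => (List.take_of_length_le (hm u)).symm
    have hmono : ∀ m, goodLabel c C m → goodLabel c' C m :=
      fun m hm u => (hm u).trans (Nat.mul_le_mul_right _ hc)
    have htake : ∀ m : Fin C.n → List Bool,
        goodLabel c C fun u => (m u).take (c * Nat.log 2 C.n) :=
      fun m u => List.length_take_le _ _
    cases b
    · exact ⟨fun h m' _ => (key _ m' fun _ => rfl).1 (h _ (htake m')),
        fun h m hm => (key m m (hself m hm)).2 (h m (hmono m hm))⟩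
    · exact ⟨fun ⟨m, hm, h⟩ => ⟨m, hmono m hm, (key m m (hself m hm)).1 h⟩,
        fun ⟨m', _, h⟩ => ⟨_, htake m', (key _ m' fun _ => rfl).2 h⟩⟩

end Quantifiers

section Collapse

lemma truncLabels_update {V : Type*} {b q : ℕ} {ℓ ℓ' : ℕ → V → List Bool}
    (hℓ : ∀ i u, ℓ i u = (ℓ' i u).take b) {w w' m : V → List Bool}
    (hw : ∀ u, w u = (payload (w' u)).take b) :
    truncLabels b q (Function.update ℓ' q w') m =
      Function.update (Function.update ℓ q w) (q + 1) m := by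
  funext i u
  by_cases h₁ : i = q + 1
  · subst h₁
    simp [truncLabels]
  · by_cases h₂ : i = q
    · subst h₂
      simp [truncLabels, hw]
    · simp [truncLabels, h₁, h₂, hℓ]

lemma accepts_collapseAlg {A : LocalAlg} {c q : ℕ} {C : Config} {ident : Fin C.n → ℕ}
    {ℓ : ℕ → Fin C.n → List Bool} :
    accepts (collapseAlg A c q) C ident ℓ ↔ ∀ v, CollapseAccepts A c q C ident ℓ v := by
  simp [accepts, collapseAlg]

lemma altQ_collapseAlg_one {A : LocalAlg} {β c q : ℕ} (hβ : 1 ≤ β) {C : Config}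
    {ident : Fin C.n → ℕ} (hid : IsIdAssignment β C ident) (ℓ ℓ' : ℕ → Fin C.n → List Bool)
    (hℓ : ∀ i u, ℓ i u = (ℓ' i u).take (c * Nat.log 2 C.n)) :
    altQ c C (accepts A C ident) 2 q true ℓ ↔
      altQ (4 * (4 * β + 1) + c) C (accepts (collapseAlg A c q) C ident) 1 q true ℓ' := by
  simp only [altQ, accepts_collapseAlg]
  constructor
  · rintro ⟨w, hw, hacc⟩
    obtain ⟨v₀, f, s, hs, hcount⟩ := exists_countsAt C.conn hid.1
    rw [Fintype.card_fin] at hs hcount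
    have hn : C.n ≤ C.n ^ β := Nat.le_self_pow (by omega) _
    choose w' hlen hroot hpar hsize htot hpay using fun u =>
      exists_encoding C.npos (hid.2 v₀) (hid.2 (f u)) ⟨(hs u).1, (hs u).2.trans hn⟩
        ⟨C.npos, hn⟩ (hw u)
    refine ⟨w', hlen, fun v => ⟨?_, fun m hm => ?_⟩⟩
    · rw [Function.update_self, countsInBall_iff (by omega)]
      simpa only [hroot, hpar, hsize, htot] using hcount v
    · rw [Function.update_self, claimedBound, htot] at hm ⊢
      rw [truncLabels_update hℓ (w := w) fun u => by
        rw [hpay, List.take_of_length_le (hw u)]]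
      exact hacc m hm v
  · rintro ⟨w', hlen, hacc⟩
    have hcount := fun v => (countsInBall_iff (by omega) _).1 (hacc v).1
    simp only [Function.update_self] at hcount
    have htot : ∀ v, totalOf (w' v) = C.n := fun v => by
      simpa using eq_card_of_countsAt C.conn hid.1 hcount v
    refine ⟨fun u => (payload (w' u)).take (c * Nat.log 2 C.n),
      fun u => List.length_take_le _ _, fun m hm v => ?_⟩
    have := (hacc v).2 m
    rw [Function.update_self, claimedBound, htot, truncLabels_update hℓ fun _ => rfl] at this
    exact this hm

end Collapse

/-- For every `k ≥ 1`, `Σ_{2k} = Σ_{2k-1}`: a distributed language is in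
`Σ_{2k}` iff it is in `Σ_{2k-1}` (for any fixed constants `α` and `β ≥ 1` of the setting). -/
theorem sigma_even_collapse (α β : ℕ) (hβ : 1 ≤ β) (k : ℕ) (hk : 1 ≤ k)
    (L : Set Config) (hL : IsDistLang α L) :
    SigmaC α β (2 * k) L ↔ SigmaC α β (2 * k - 1) L := by
  obtain ⟨j, rfl⟩ := Nat.exists_eq_add_of_le' hk
  rw [show 2 * (j + 1) - 1 = 2 * j + 1 by omega, show 2 * (j + 1) = 2 * j + 2 by omega]
  constructor
  · rintro ⟨A, c, h⟩
    refine ⟨collapseAlg A c (2 * j), 4 * (4 * β + 1) + c, fun C hC ident hid => ?_⟩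
    rw [h C hC ident hid]
    exact altQ_iff_altQ_of_truncate (by omega) (altQ_collapseAlg_one hβ hid) (2 * j) 0 true
      (by simp) _ _ (by omega) fun _ _ => by simp [noLabels]
  · rintro ⟨A, c, h⟩
    refine ⟨eraseAlg A (2 * j + 1), c, fun C hC ident hid => ?_⟩
    rw [h C hC ident hid]
    exact altQ_iff_altQ_succ (fun _ => Iff.rfl) (2 * j + 1) 0 true _ (by omega) rfl
end

section
/- For every integer k ≥ 1, the classes Π_{2k+1} and Π_{2k} of the local hierarchy coincide: a distributed language is in Π_{2k+1} if and only if it is in Π_{2k}. -/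
namespace LocalHierarchy

/-! ### Alternating quantification under a change of labellings -/

/-- If `F` turns the updates of a sequence of labellings by labellings of size `c'` into the updates
by labellings of size `c`, then two alternating prefixes agree as soon as their tails do. -/
lemma altQ_iff_of_map {c c' : ℕ} {C : Config} {P P' : (ℕ → Fin C.n → List Bool) → Prop}
    {F : (ℕ → Fin C.n → List Bool) → ℕ → Fin C.n → List Bool} {M a a' : ℕ} {b₀ : Bool}
    (hto : ∀ i < M, ∀ ℓs ℓ, goodLabel c' C ℓ →
      ∃ ℓ₂, goodLabel c C ℓ₂ ∧ F (Function.update ℓs i ℓ) = Function.update (F ℓs) i ℓ₂)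
    (hfrom : ∀ i < M, ∀ ℓs ℓ₂, goodLabel c C ℓ₂ →
      ∃ ℓ, goodLabel c' C ℓ ∧ F (Function.update ℓs i ℓ) = Function.update (F ℓs) i ℓ₂)
    (hbase : ∀ ℓs, altQ c' C P' a' M b₀ ℓs ↔ altQ c C P a M b₀ (F ℓs)) :
    ∀ j i b, i + j = M → (b ^^ j.bodd) = b₀ → ∀ ℓs,
      (altQ c' C P' (a' + j) i b ℓs ↔ altQ c C P (a + j) i b (F ℓs)) := by
  intro j
  induction j with
  | zero =>
    intro i b hi hb ℓs
    simp only [Nat.bodd_zero, Bool.xor_false] at hb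
    subst hb
    simp only [add_zero] at hi ⊢
    subst hi
    exact hbase ℓs
  | succ j ih =>
    intro i b hi hb ℓs
    have hi' : i + 1 + j = M := by omega
    have hiM : i < M := by omega
    have hb' : ((!b) ^^ j.bodd) = b₀ := by
      rw [← hb, Nat.bodd_succ]
      cases b <;> cases j.bodd <;> rfl
    have step := ih (i + 1) (!b) hi' hb'
    rw [← add_assoc, ← add_assoc]
    cases b with
    | true =>
      simp only [altQ]
      constructor
      · rintro ⟨ℓ, hℓ, h⟩
        obtain ⟨ℓ₂, h₂, e⟩ := hto i hiM ℓs ℓ hℓ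
        exact ⟨ℓ₂, h₂, e ▸ (step _).1 h⟩
      · rintro ⟨ℓ₂, h₂, h⟩
        obtain ⟨ℓ, hℓ, e⟩ := hfrom i hiM ℓs ℓ₂ h₂
        exact ⟨ℓ, hℓ, (step _).2 (e ▸ h)⟩
    | false =>
      simp only [altQ]
      constructor
      · intro h ℓ₂ h₂
        obtain ⟨ℓ, hℓ, e⟩ := hfrom i hiM ℓs ℓ₂ h₂
        exact e ▸ (step _).1 (h ℓ hℓ)
      · intro h ℓ hℓ
        obtain ⟨ℓ₂, h₂, e⟩ := hto i hiM ℓs ℓ hℓ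
        exact (step _).2 (e ▸ h ℓ₂ h₂)

/-! ### Isomorphisms of labelled balls -/

/-- An isomorphism of labelled balls of radius `T`, presented by maps on all nodes. -/
structure BallEquiv (T : ℕ) (C C' : Config) (ident : Fin C.n → ℕ) (ident' : Fin C'.n → ℕ)
    (ℓ : ℕ → Fin C.n → List Bool) (ℓ' : ℕ → Fin C'.n → List Bool)
    (v : Fin C.n) (v' : Fin C'.n) where
  f : Fin C.n → Fin C'.n
  g : Fin C'.n → Fin C.n
  map_center : f v = v'
  f_mem : ∀ u ∈ ball C v T, f u ∈ ball C' v' T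
  g_mem : ∀ u ∈ ball C' v' T, g u ∈ ball C v T
  g_f : ∀ u ∈ ball C v T, g (f u) = u
  f_g : ∀ u ∈ ball C' v' T, f (g u) = u
  adj : ∀ u ∈ ball C v T, ∀ w ∈ ball C v T, C'.G.Adj (f u) (f w) ↔ C.G.Adj u w
  input : ∀ u ∈ ball C v T, C'.x (f u) = C.x u
  ident_eq : ∀ u ∈ ball C v T, ident' (f u) = ident u
  label : ∀ i, ∀ u ∈ ball C v T, ℓ' i (f u) = ℓ i u

lemma exists_adj_dist_le {V : Type*} {G : SimpleGraph V} (hG : G.Connected) {a v : V} {d : ℕ}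
    (h : G.dist a v ≤ d + 1) (hne : v ≠ a) : ∃ w, G.Adj w v ∧ G.dist a w ≤ d := by
  obtain ⟨p, hp⟩ := hG.exists_walk_length_eq_dist v a
  rw [SimpleGraph.dist_comm] at hp
  cases p with
  | nil => exact absurd rfl hne
  | cons hadj q =>
    refine ⟨_, hadj.symm, ?_⟩
    rw [SimpleGraph.dist_comm]
    have := SimpleGraph.dist_le q
    simp only [SimpleGraph.Walk.length_cons] at hp
    omega

lemma ball_mono (C : Config) (v : Fin C.n) {t T : ℕ} (h : t ≤ T) : ball C v t ⊆ ball C v T :=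
  fun _ hu => le_trans (show _ ≤ t from hu) h

lemma mem_ball_of_adj {C : Config} {v u : Fin C.n} (h : C.G.Adj v u) {T : ℕ} (hT : 1 ≤ T) :
    u ∈ ball C v T := by
  have h1 : C.G.dist v u = 1 := SimpleGraph.dist_eq_one_iff_adj.2 h
  exact (show C.G.dist v u ≤ T from h1.le.trans hT)

namespace BallEquiv

variable {T : ℕ} {C C' : Config} {ident : Fin C.n → ℕ} {ident' : Fin C'.n → ℕ}
  {ℓ : ℕ → Fin C.n → List Bool} {ℓ' : ℕ → Fin C'.n → List Bool} {v' : Fin C'.n} {v : Fin C.n}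

/-- The inverse of an isomorphism of labelled balls. -/
def symm (e : BallEquiv T C C' ident ident' ℓ ℓ' v v') :
    BallEquiv T C' C ident' ident ℓ' ℓ v' v where
  f := e.g
  g := e.f
  map_center := (congrArg e.g e.map_center).symm.trans (e.g_f v (self_mem_ball C v T))
  f_mem := e.g_mem
  g_mem := e.f_mem
  g_f := e.f_g
  f_g := e.g_f
  adj u hu w hw := by
    rw [← e.adj _ (e.g_mem u hu) _ (e.g_mem w hw), e.f_g u hu, e.f_g w hw]
  input u hu := by rw [← e.input _ (e.g_mem u hu), e.f_g u hu]
  ident_eq u hu := by rw [← e.ident_eq _ (e.g_mem u hu), e.f_g u hu]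
  label i u hu := by rw [← e.label i _ (e.g_mem u hu), e.f_g u hu]

lemma dist_le (e : BallEquiv T C C' ident ident' ℓ ℓ' v v') :
    ∀ d ≤ T, ∀ u, C.G.dist v u ≤ d → C'.G.dist v' (e.f u) ≤ d := by
  intro d
  induction d with
  | zero =>
    intro _ u hu
    have : v = u := (C.conn.preconnected v u).dist_eq_zero_iff.1 (Nat.le_zero.1 hu)
    subst this
    simp [e.map_center]
  | succ d ih =>
    intro hd u hu
    by_cases huv : u = v
    · subst huv
      simp [e.map_center]
    obtain ⟨w, hwu, hw⟩ := exists_adj_dist_le C.conn hu huv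
    have hwT : w ∈ ball C v T := hw.trans (by omega)
    have huT : u ∈ ball C v T := hu.trans hd
    have h1 : C'.G.dist (e.f w) (e.f u) = 1 :=
      SimpleGraph.dist_eq_one_iff_adj.2 ((e.adj w hwT u huT).2 hwu)
    have h2 := ih (by omega) w hw
    have h3 := C'.conn.dist_triangle (u := v') (v := e.f w) (w := e.f u)
    omega

/-- Restriction of an isomorphism of labelled balls to a smaller radius. -/
def restrict (e : BallEquiv T C C' ident ident' ℓ ℓ' v v') {t : ℕ} (h : t ≤ T) :
    BallEquiv t C C' ident ident' ℓ ℓ' v v' where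
  f := e.f
  g := e.g
  map_center := e.map_center
  f_mem := e.dist_le t h
  g_mem := e.symm.dist_le t h
  g_f u hu := e.g_f u (ball_mono C v h hu)
  f_g u hu := e.f_g u (ball_mono C' v' h hu)
  adj u hu w hw := e.adj u (ball_mono C v h hu) w (ball_mono C v h hw)
  input u hu := e.input u (ball_mono C v h hu)
  ident_eq u hu := e.ident_eq u (ball_mono C v h hu)
  label i u hu := e.label i u (ball_mono C v h hu)

/-- Change of the labellings carried by an isomorphism of labelled balls. -/
def withLabels (e : BallEquiv T C C' ident ident' ℓ ℓ' v v')
    (κ : ℕ → Fin C.n → List Bool) (κ' : ℕ → Fin C'.n → List Bool)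
    (h : ∀ i, ∀ u ∈ ball C v T, κ' i (e.f u) = κ i u) :
    BallEquiv T C C' ident ident' κ κ' v v' :=
  { e with label := h }

lemma run_eq {A : LocalAlg} (e : BallEquiv A.t C C' ident ident' ℓ ℓ' v v') :
    A.run C ident ℓ v = A.run C' ident' ℓ' v' :=
  A.isLocal C C' ident ident' ℓ ℓ' v v'
    { toFun := fun u => ⟨e.f u.1, e.f_mem u.1 u.2⟩
      invFun := fun u => ⟨e.g u.1, e.g_mem u.1 u.2⟩
      left_inv := fun u => Subtype.ext (e.g_f u.1 u.2)
      right_inv := fun u => Subtype.ext (e.f_g u.1 u.2)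
      map_rel_iff' := fun {u w} => e.adj u.1 u.2 w.1 w.2 }
    e.map_center (fun u => e.input u.1 u.2) (fun u => e.ident_eq u.1 u.2)
    (fun i u => e.label i u.1 u.2)

open Classical in
/-- The isomorphism of labelled balls given by an isomorphism of induced subgraphs. -/
noncomputable def ofIso (φ : (C.G.induce (ball C v T)) ≃g (C'.G.induce (ball C' v' T)))
    (h₁ : (φ ⟨v, self_mem_ball C v T⟩).val = v')
    (h₂ : ∀ u : ball C v T, C'.x (φ u).val = C.x u.val)
    (h₃ : ∀ u : ball C v T, ident' (φ u).val = ident u.val)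
    (h₄ : ∀ (i : ℕ) (u : ball C v T), ℓ' i (φ u).val = ℓ i u.val) :
    BallEquiv T C C' ident ident' ℓ ℓ' v v' where
  f u := if h : u ∈ ball C v T then (φ ⟨u, h⟩).1 else v'
  g u := if h : u ∈ ball C' v' T then (φ.symm ⟨u, h⟩).1 else v
  map_center := by rw [dif_pos (self_mem_ball C v T), h₁]
  f_mem u hu := by rw [dif_pos hu]; exact (φ ⟨u, hu⟩).2
  g_mem u hu := by rw [dif_pos hu]; exact (φ.symm ⟨u, hu⟩).2
  g_f u hu := by simp [hu]
  f_g u hu := by simp [hu]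
  adj u hu w hw := by
    rw [dif_pos hu, dif_pos hw]
    exact φ.map_rel_iff (a := ⟨u, hu⟩) (b := ⟨w, hw⟩)
  input u hu := by rw [dif_pos hu]; exact h₂ ⟨u, hu⟩
  ident_eq u hu := by rw [dif_pos hu]; exact h₃ ⟨u, hu⟩
  label i u hu := by rw [dif_pos hu]; exact h₄ i ⟨u, hu⟩

end BallEquiv

open Classical in
/-- A local algorithm given by a predicate that is preserved by isomorphisms of labelled balls. -/
noncomputable def algOfPred (T : ℕ)
    (Q : (C : Config) → (Fin C.n → ℕ) → (ℕ → Fin C.n → List Bool) → Fin C.n → Prop)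
    (hQ : ∀ (C C' : Config) (ident : Fin C.n → ℕ) (ident' : Fin C'.n → ℕ)
      (ℓ : ℕ → Fin C.n → List Bool) (ℓ' : ℕ → Fin C'.n → List Bool) (v : Fin C.n) (v' : Fin C'.n),
      BallEquiv T C C' ident ident' ℓ ℓ' v v' → Q C ident ℓ v → Q C' ident' ℓ' v') :
    LocalAlg where
  t := T
  run C ident ℓ v := decide (Q C ident ℓ v)
  isLocal C C' ident ident' ℓ ℓ' v v' φ h₁ h₂ h₃ h₄ := by
    have e := BallEquiv.ofIso φ h₁ h₂ h₃ h₄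
    exact decide_eq_decide.2 ⟨hQ _ _ _ _ _ _ _ _ e, hQ _ _ _ _ _ _ _ _ e.symm⟩

lemma accepts_algOfPred {T : ℕ}
    {Q : (C : Config) → (Fin C.n → ℕ) → (ℕ → Fin C.n → List Bool) → Fin C.n → Prop} {hQ}
    {C : Config} {ident : Fin C.n → ℕ} {ℓ : ℕ → Fin C.n → List Bool} :
    accepts (algOfPred T Q hQ) C ident ℓ ↔ ∀ v, Q C ident ℓ v := by
  simp [accepts, algOfPred]

/-! ### Bit string encodings -/

/-- The natural number with given binary digits, least significant first. -/
def bitsToNat (l : List Bool) : ℕ := l.foldr Nat.bit 0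

lemma bitsToNat_bits (n : ℕ) : bitsToNat n.bits = n := by
  induction n using Nat.binaryRec' with
  | zero => simp [bitsToNat]
  | bit b n h ih =>
    rw [Nat.bits_append_bit n b h]
    simp only [bitsToNat, List.foldr_cons] at ih ⊢
    rw [ih]

/-- Self-delimiting encoding of a pair of bit strings. -/
def pairBits : List Bool → List Bool → List Bool
  | [], r => false :: r
  | b :: l, r => true :: b :: pairBits l r

/-- Decoding of a pair of bit strings. -/
def unpairBits : List Bool → List Bool × List Bool
  | true :: b :: l => (b :: (unpairBits l).1, (unpairBits l).2)
  | false :: r => ([], r)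
  | _ => ([], [])

lemma unpairBits_pairBits (l r : List Bool) : unpairBits (pairBits l r) = (l, r) := by
  induction l with
  | nil => rfl
  | cons b l ih => simp [pairBits, unpairBits, ih]

lemma length_pairBits (l r : List Bool) :
    (pairBits l r).length = 2 * l.length + 1 + r.length := by
  induction l with
  | nil => simp [pairBits]; omega
  | cons b l ih => simp [pairBits, ih]; omega

/-- The leading positive number stored in a bit string. -/
def headNum (l : List Bool) : ℕ := bitsToNat (unpairBits l).1 + 1

/-- What remains of a bit string after its leading number. -/
def tailBits (l : List Bool) : List Bool := (unpairBits l).2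

/-- Prepend a positive number to a bit string. -/
def consNum (a : ℕ) (l : List Bool) : List Bool := pairBits (a - 1).bits l

lemma headNum_consNum {a : ℕ} (ha : 1 ≤ a) (l : List Bool) : headNum (consNum a l) = a := by
  simp only [headNum, consNum, unpairBits_pairBits, bitsToNat_bits]
  omega

lemma tailBits_consNum (a : ℕ) (l : List Bool) : tailBits (consNum a l) = l := by
  simp [tailBits, consNum, unpairBits_pairBits]

lemma length_consNum_le {a n β : ℕ} (hn : 2 ≤ n) (ha : a ≤ n ^ β) (l : List Bool) :
    (consNum a l).length ≤ (4 * β + 1) * Nat.log 2 n + l.length := by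
  have hL : 1 ≤ Nat.log 2 n := Nat.log_pos (by norm_num) hn
  have h1 : (a - 1).bits.length ≤ (Nat.log 2 n + 1) * β := by
    rw [Nat.size_eq_bits_len, Nat.size_le]
    calc a - 1 < n ^ β := by
          have : 0 < n ^ β := by positivity
          omega
      _ ≤ (2 ^ (Nat.log 2 n + 1)) ^ β :=
          Nat.pow_le_pow_left (Nat.lt_pow_succ_log_self (by norm_num) n).le β
      _ = 2 ^ ((Nat.log 2 n + 1) * β) := (pow_mul _ _ _).symm
  rw [consNum, length_pairBits]
  nlinarith

/-! ### Certificates for the number of nodes -/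

/-- The claimed number of nodes. -/
def certSize (l : List Bool) : ℕ := headNum l

/-- The identity of the claimed root. -/
def certRoot (l : List Bool) : ℕ := headNum (tailBits l)

/-- The identity of the parent. -/
def certParent (l : List Bool) : ℕ := headNum (tailBits (tailBits l))

/-- The claimed number of descendants. -/
def certCount (l : List Bool) : ℕ := headNum (tailBits (tailBits (tailBits l)))

/-- The part of a label that follows the certificate. -/
def payload (l : List Bool) : List Bool := tailBits (tailBits (tailBits (tailBits l)))

lemma exists_code {n β c N r p s : ℕ} (hn : 1 ≤ n) (hN : 1 ≤ N) (hr : 1 ≤ r) (hp : 1 ≤ p)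
    (hs : 1 ≤ s) (hN' : N ≤ n ^ β) (hr' : r ≤ n ^ β) (hp' : p ≤ n ^ β) (hs' : s ≤ n ^ β)
    {l : List Bool} (hl : l.length ≤ c * Nat.log 2 n) :
    ∃ m : List Bool, m.length ≤ (c + 4 * (4 * β + 1)) * Nat.log 2 n ∧ certSize m = N ∧
      certRoot m = r ∧ certParent m = p ∧ certCount m = s ∧ payload m = l := by
  rcases hn.eq_or_lt with rfl | hn
  · simp only [Nat.log_one_right, mul_zero, Nat.le_zero, List.length_eq_zero_iff] at hl
    simp only [one_pow] at hN' hr' hp' hs'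
    obtain rfl := le_antisymm hN' hN
    obtain rfl := le_antisymm hr' hr
    obtain rfl := le_antisymm hp' hp
    obtain rfl := le_antisymm hs' hs
    exact ⟨[], by simp, rfl, rfl, rfl, rfl, hl.symm⟩
  · refine ⟨consNum N (consNum r (consNum p (consNum s l))), ?_, ?_⟩
    · have h1 := length_consNum_le hn hN' (consNum r (consNum p (consNum s l)))
      have h2 := length_consNum_le hn hr' (consNum p (consNum s l))
      have h3 := length_consNum_le hn hp' (consNum s l)
      have h4 := length_consNum_le hn hs' l
      nlinarith
    · simp [certSize, certRoot, certParent, certCount, payload, tailBits_consNum,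
        headNum_consNum, hN, hr, hp, hs]

/-- Descendant counts for a parent map whose only possible root is `r`. -/
lemma count_eq_card {V : Type*} [Fintype V] [DecidableEq V] {par : V → V} {s : V → ℕ} {r : V}
    (hs : ∀ v, s v = 1 + ∑ u with u ≠ v ∧ par u = v, s u) (hr : ∀ v, par v = v → v = r) :
    par r = r ∧ s r = Fintype.card V ∧ ∀ v, s v ≤ Fintype.card V := by
  obtain ⟨w, -, hw⟩ := Finset.exists_max_image Finset.univ s ⟨r, Finset.mem_univ r⟩
  have hpw : par w = w := by
    by_contra hne
    have h1 : s w ≤ ∑ u with u ≠ par w ∧ par u = par w, s u :=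
      Finset.single_le_sum (f := s) (fun _ _ => Nat.zero_le _) (by simp [Ne.symm hne])
    have h2 := hs (par w)
    have h3 := hw (par w) (Finset.mem_univ _)
    omega
  obtain rfl := hr w hpw
  have key : s w = Fintype.card V := by
    have h1 : ∑ v, s v = Fintype.card V + ∑ v, ∑ u with u ≠ v ∧ par u = v, s u := by
      conv_lhs => rw [Finset.sum_congr rfl fun v _ => hs v]
      simp [Finset.sum_add_distrib]
    have h2 : ∑ v, ∑ u with u ≠ v ∧ par u = v, s u = ∑ u, if u = w then 0 else s u := by
      simp only [Finset.sum_filter]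
      rw [Finset.sum_comm]
      refine Finset.sum_congr rfl fun u _ => ?_
      rw [Finset.sum_eq_single (par u)]
      · by_cases h : u = w
        · simp [h, hpw]
        · have : u ≠ par u := fun h' => h (hr u h'.symm)
          simp [h, this]
      · intro v _ hv
        rw [if_neg]
        exact fun h => hv h.2.symm
      · simp
    have h3 : ∑ v, s v = s w + ∑ u, if u = w then 0 else s u := by
      rw [← Finset.add_sum_erase Finset.univ s (Finset.mem_univ w),
        ← Finset.add_sum_erase Finset.univ (fun u => if u = w then 0 else s u)
          (Finset.mem_univ w)]
      simp only [if_true, zero_add]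
      congr 1
      refine Finset.sum_congr rfl fun u hu => ?_
      rw [if_neg (Finset.ne_of_mem_erase hu)]
    omega
  exact ⟨hpw, key, fun v => key ▸ hw v (Finset.mem_univ v)⟩

open Classical in
/-- The local verification of a certificate: a rooted spanning tree with descendant counts. -/
def CertOK (C : Config) (ident : Fin C.n → ℕ) (ℓ : Fin C.n → List Bool) (v : Fin C.n) : Prop :=
  (∀ u, C.G.Adj v u → certSize (ℓ u) = certSize (ℓ v) ∧ certRoot (ℓ u) = certRoot (ℓ v)) ∧
  (∃ w, (w = v ∨ C.G.Adj v w) ∧ ident w = certParent (ℓ v)) ∧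
  (certParent (ℓ v) = ident v →
    ident v = certRoot (ℓ v) ∧ certCount (ℓ v) = certSize (ℓ v)) ∧
  certCount (ℓ v) =
    1 + ∑ u with C.G.Adj v u ∧ certParent (ℓ u) = ident v, certCount (ℓ u)

lemma CertOK.map {T : ℕ} (hT : 1 ≤ T) {C C' : Config} {ident : Fin C.n → ℕ}
    {ident' : Fin C'.n → ℕ} {ℓ : ℕ → Fin C.n → List Bool} {ℓ' : ℕ → Fin C'.n → List Bool}
    {v : Fin C.n} {v' : Fin C'.n} (e : BallEquiv T C C' ident ident' ℓ ℓ' v v') (i : ℕ)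
    (h : CertOK C ident (ℓ i) v) : CertOK C' ident' (ℓ' i) v' := by
  have hv := self_mem_ball C v T
  have hv' := self_mem_ball C' v' T
  have hlv : ℓ' i v' = ℓ i v := by rw [← e.label i v hv, e.map_center]
  have hiv : ident' v' = ident v := by rw [← e.ident_eq v hv, e.map_center]
  have hf : ∀ u, C.G.Adj v u → C'.G.Adj v' (e.f u) := fun u hu => by
    have h := (e.adj v hv u (mem_ball_of_adj hu hT)).2 hu
    rwa [e.map_center] at h
  have hg : ∀ u, C'.G.Adj v' u → C.G.Adj v (e.g u) := fun u hu => by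
    have h := (e.symm.adj v' hv' u (mem_ball_of_adj hu hT)).2 hu
    rwa [e.symm.map_center] at h
  have hgl : ∀ u, C'.G.Adj v' u → ℓ i (e.g u) = ℓ' i u := fun u hu =>
    e.symm.label i u (mem_ball_of_adj hu hT)
  obtain ⟨h1, ⟨w, hw, hwp⟩, h3, h4⟩ := h
  refine ⟨fun u hu => ?_, ?_, ?_, ?_⟩
  · rw [hlv, ← hgl u hu]
    exact h1 _ (hg u hu)
  · rw [hlv]
    rcases hw with rfl | hw
    · exact ⟨v', Or.inl rfl, hiv.trans hwp⟩
    · exact ⟨e.f w, Or.inr (hf w hw), (e.ident_eq w (mem_ball_of_adj hw hT)).trans hwp⟩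
  · rw [hlv, hiv]
    exact h3
  · rw [hlv, hiv, h4]
    congr 1
    refine Finset.sum_nbij' e.f e.g ?_ ?_ ?_ ?_ ?_
    · intro u hu
      simp only [Finset.mem_filter, Finset.mem_univ, true_and] at hu ⊢
      exact ⟨hf u hu.1, by rw [e.label i u (mem_ball_of_adj hu.1 hT)]; exact hu.2⟩
    · intro u hu
      simp only [Finset.mem_filter, Finset.mem_univ, true_and] at hu ⊢
      exact ⟨hg u hu.1, by rw [hgl u hu.1]; exact hu.2⟩
    · intro u hu
      simp only [Finset.mem_filter, Finset.mem_univ, true_and] at hu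
      exact e.g_f u (mem_ball_of_adj hu.1 hT)
    · intro u hu
      simp only [Finset.mem_filter, Finset.mem_univ, true_and] at hu
      exact e.f_g u (mem_ball_of_adj hu.1 hT)
    · intro u hu
      simp only [Finset.mem_filter, Finset.mem_univ, true_and] at hu
      rw [e.label i u (mem_ball_of_adj hu.1 hT)]

lemma eq_of_adj_imp_eq {V α : Type*} {G : SimpleGraph V} (hG : G.Connected) {f : V → α}
    (h : ∀ u v, G.Adj u v → f v = f u) (u v : V) : f u = f v := by
  obtain ⟨p⟩ := hG.preconnected u v
  induction p with
  | nil => rfl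
  | cons hadj _ ih => exact (h _ _ hadj).symm.trans ih

lemma certSize_eq {C : Config} {ident : Fin C.n → ℕ} (hid : Function.Injective ident)
    {ℓ : Fin C.n → List Bool} (h : ∀ v, CertOK C ident ℓ v) (v : Fin C.n) :
    certSize (ℓ v) = C.n := by
  classical
  have hsize := eq_of_adj_imp_eq C.conn (f := fun v => certSize (ℓ v))
    fun u v huv => ((h u).1 v huv).1
  have hroot := eq_of_adj_imp_eq C.conn (f := fun v => certRoot (ℓ v))
    fun u v huv => ((h u).1 v huv).2
  choose par hpar hparent using fun v => (h v).2.1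
  have hchild : ∀ v u, (C.G.Adj v u ∧ certParent (ℓ u) = ident v) ↔ (u ≠ v ∧ par u = v) := by
    intro v u
    constructor
    · rintro ⟨hadj, hp⟩
      exact ⟨hadj.ne', hid ((hparent u).trans hp)⟩
    · rintro ⟨hne, rfl⟩
      refine ⟨?_, (hparent u).symm⟩
      rcases hpar u with h' | h'
      · exact absurd h'.symm hne
      · exact h'.symm
  have hs : ∀ v, certCount (ℓ v) = 1 + ∑ u with u ≠ v ∧ par u = v, certCount (ℓ u) := by
    intro v
    rw [(h v).2.2.2]
    congr 1
    refine Finset.sum_congr (Finset.ext fun u => ?_) fun _ _ => rfl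
    simp only [Finset.mem_filter, Finset.mem_univ, true_and]
    exact hchild v u
  have hfix : ∀ v, par v = v → certParent (ℓ v) = ident v := fun v hv => by
    rw [← hparent v, hv]
  have hex : ∃ r, par r = r := by
    by_contra! hno
    have := (count_eq_card (r := v) hs fun u hu => absurd hu (hno u)).1
    exact hno v this
  obtain ⟨r, hr⟩ := hex
  have huniq : ∀ u, par u = u → u = r := fun u hu => hid <| by
    rw [((h u).2.2.1 (hfix u hu)).1, ((h r).2.2.1 (hfix r hr)).1]
    exact hroot u r
  have hcard := (count_eq_card hs huniq).2.1
  rw [Fintype.card_fin] at hcard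
  rw [hsize v r, ← hcard]
  exact ((h r).2.2.1 (hfix r hr)).2.symm

lemma exists_count {V : Type*} [Fintype V] [DecidableEq V] (par : V → V) (depth : V → ℕ)
    (h : ∀ u, par u ≠ u → depth (par u) < depth u) :
    ∃ s : V → ℕ, ∀ v, s v = 1 + ∑ u with u ≠ v ∧ par u = v, s u := by
  have wf : WellFounded fun u v : V => depth v < depth u := by
    have : IsTrans V fun u v : V => depth v < depth u := ⟨fun _ _ _ h₁ h₂ => h₂.trans h₁⟩
    have : Std.Irrefl fun u v : V => depth v < depth u := ⟨fun _ => lt_irrefl _⟩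
    exact Finite.wellFounded_of_trans_of_irrefl _
  let F : (v : V) → ((u : V) → depth v < depth u → ℕ) → ℕ := fun v rec =>
    1 + ∑ u, if hu : u ≠ v ∧ par u = v then
      rec u (by obtain ⟨h₁, rfl⟩ := hu; exact h u h₁.symm) else 0
  refine ⟨wf.fix F, fun v => ?_⟩
  rw [wf.fix_eq F v, Finset.sum_filter]
  simp only [F, dite_eq_ite]

lemma exists_cert {β c : ℕ} (hβ : 1 ≤ β) {C : Config} {ident : Fin C.n → ℕ}
    (hid : IsIdAssignment β C ident) {ℓ : Fin C.n → List Bool} (hℓ : goodLabel c C ℓ) :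
    ∃ κ : Fin C.n → List Bool, goodLabel (c + 4 * (4 * β + 1)) C κ ∧
      (∀ v, CertOK C ident κ v) ∧ ∀ v, payload (κ v) = ℓ v := by
  classical
  let r : Fin C.n := ⟨0, C.npos⟩
  have hpar : ∀ v, ∃ w, (v = r → w = r) ∧
      (v ≠ r → C.G.Adj w v ∧ C.G.dist r w < C.G.dist r v) := by
    intro v
    by_cases hv : v = r
    · exact ⟨r, fun _ => rfl, fun h => absurd hv h⟩
    · have hpos : 0 < C.G.dist r v := C.conn.pos_dist_of_ne (Ne.symm hv)
      obtain ⟨w, hw, hd⟩ := exists_adj_dist_le (d := C.G.dist r v - 1) C.conn (by omega) hv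
      exact ⟨w, fun h => absurd h hv, fun _ => ⟨hw, by omega⟩⟩
  choose par hpr hpn using hpar
  have hfix : ∀ u, par u = u → u = r := fun u hu => by
    by_contra hne
    have := (hpn u hne).2
    rw [hu] at this
    exact lt_irrefl _ this
  have hdepth : ∀ u, par u ≠ u → C.G.dist r (par u) < C.G.dist r u := fun u hu =>
    (hpn u fun h => hu ((hpr u h).trans h.symm)).2
  obtain ⟨s, hs⟩ := exists_count par (fun v => C.G.dist r v) hdepth
  obtain ⟨-, hsr, hsle⟩ := count_eq_card hs hfix
  rw [Fintype.card_fin] at hsr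
  simp only [Fintype.card_fin] at hsle
  have hn : C.n ≤ C.n ^ β := Nat.le_self_pow (by omega) _
  choose κ hκ hN hr hp hc hl using fun v => exists_code (c := c) C.npos C.npos (hid.2 r).1
    (hid.2 (par v)).1 (show 1 ≤ s v by rw [hs v]; omega) hn (hid.2 r).2 (hid.2 (par v)).2
    ((hsle v).trans hn) (hℓ v)
  refine ⟨κ, hκ, fun v => ⟨fun u _ => ?_, ⟨par v, ?_, (hp v).symm⟩, fun h => ?_, ?_⟩, hl⟩
  · simp [hN, hr]
  · by_cases hv : v = r
    · exact Or.inl ((hpr v hv).trans hv.symm)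
    · exact Or.inr (hpn v hv).1.symm
  · rw [hp] at h
    obtain rfl := hfix v (hid.1 h)
    exact ⟨(hr _).symm, by rw [hc, hN, hsr]⟩
  · simp only [hc, hp]
    rw [hs v]
    congr 1
    refine Finset.sum_congr (Finset.ext fun u => ?_) fun _ _ => rfl
    simp only [Finset.mem_filter, Finset.mem_univ, true_and]
    constructor
    · rintro ⟨hne, rfl⟩
      exact ⟨(hpn u fun h => hne ((hpr u h).trans h.symm).symm).1, rfl⟩
    · rintro ⟨hadj, hpe⟩
      exact ⟨hadj.ne', hid.1 hpe⟩

/-! ### Eliminating the last universal quantifier -/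

/-- Truncate all labellings to length `K`. -/
def truncLabels {V : Type*} (K : ℕ) (ℓs : ℕ → V → List Bool) : ℕ → V → List Bool :=
  fun i u => (ℓs i u).take K

lemma truncLabels_update {V : Type*} (K i : ℕ) (ℓs : ℕ → V → List Bool) (ℓ : V → List Bool) :
    truncLabels K (Function.update ℓs i ℓ) =
      Function.update (truncLabels K ℓs) i fun u => (ℓ u).take K := by
  funext j u
  by_cases h : j = i
  · subst h
    simp [truncLabels]
  · simp [truncLabels, h]

/-- The labellings read off from labellings whose `m`-th entry carries a certificate, together
with a further labelling `b`. -/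
def simLabels {V : Type*} (K m : ℕ) (ℓs : ℕ → V → List Bool) (b : V → List Bool) :
    ℕ → V → List Bool :=
  Function.update (Function.update (truncLabels K ℓs) m fun u => (payload (ℓs m u)).take K)
    (m + 1) b

lemma simLabels_update {V : Type*} (K m : ℕ) (ℓs : ℕ → V → List Bool) (ℓ b : V → List Bool) :
    simLabels K m (Function.update ℓs m ℓ) b =
      Function.update (Function.update (truncLabels K ℓs) m fun u => (payload (ℓ u)).take K)
        (m + 1) b := by
  simp [simLabels, truncLabels_update]

/-- Simulation of a last universal labelling of size `c`: the number of nodes is certified by the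
`m`-th labelling. -/
def SimPred (A : LocalAlg) (c m : ℕ) (C : Config) (ident : Fin C.n → ℕ)
    (ℓs : ℕ → Fin C.n → List Bool) (v : Fin C.n) : Prop :=
  CertOK C ident (ℓs m) v ∧
    ∀ b : Fin C.n → List Bool, (∀ u, (b u).length ≤ c * Nat.log 2 (certSize (ℓs m v))) →
      A.run C ident (simLabels (c * Nat.log 2 (certSize (ℓs m v))) m ℓs b) v = true

lemma SimPred.map (A : LocalAlg) (c m : ℕ) (C C' : Config) (ident : Fin C.n → ℕ)
    (ident' : Fin C'.n → ℕ) (ℓ : ℕ → Fin C.n → List Bool) (ℓ' : ℕ → Fin C'.n → List Bool)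
    (v : Fin C.n) (v' : Fin C'.n) (e : BallEquiv (A.t + 1) C C' ident ident' ℓ ℓ' v v')
    (h : SimPred A c m C ident ℓ v) : SimPred A c m C' ident' ℓ' v' := by
  refine ⟨h.1.map (by omega) e m, fun b hb => ?_⟩
  have hlv : ℓ' m v' = ℓ m v := by
    rw [← e.label m v (self_mem_ball C v _), e.map_center]
  rw [hlv] at hb ⊢
  rw [← h.2 (fun u => b (e.f u)) fun u => hb _]
  refine (BallEquiv.run_eq ((e.withLabels _ _ fun i u hu => ?_).restrict (Nat.le_succ _))).symm
  have hl := fun i => e.label i u hu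
  simp only [simLabels, Function.update_apply]
  split_ifs <;> simp [truncLabels, hl]

/-- The algorithm simulating a last universal labelling. -/
noncomputable def simAlg (A : LocalAlg) (c m : ℕ) : LocalAlg :=
  algOfPred (A.t + 1) (SimPred A c m) (SimPred.map A c m)

lemma accepts_simAlg_iff {A : LocalAlg} {c m : ℕ} {C : Config} {ident : Fin C.n → ℕ}
    (hid : Function.Injective ident) {ℓs : ℕ → Fin C.n → List Bool} :
    accepts (simAlg A c m) C ident ℓs ↔ (∀ v, CertOK C ident (ℓs m) v) ∧
      ∀ b, goodLabel c C b →
        accepts A C ident (simLabels (c * Nat.log 2 C.n) m ℓs b) := by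
  rw [simAlg, accepts_algOfPred]
  constructor
  · intro h
    have hc := fun v => (h v).1
    refine ⟨hc, fun b hb v => ?_⟩
    have := (h v).2 b
    rw [certSize_eq hid hc v] at this
    exact this hb
  · rintro ⟨hc, h⟩ v
    refine ⟨hc v, ?_⟩
    rw [certSize_eq hid hc v]
    exact fun b hb => h b hb v

lemma exists_accepts_simAlg_iff {β : ℕ} (hβ : 1 ≤ β) {A : LocalAlg} {c m : ℕ} {C : Config}
    {ident : Fin C.n → ℕ} (hid : IsIdAssignment β C ident) (ℓs : ℕ → Fin C.n → List Bool) :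
    altQ (c + 4 * (4 * β + 1)) C (accepts (simAlg A c m) C ident) 1 m true ℓs ↔
      altQ c C (accepts A C ident) 2 m true (truncLabels (c * Nat.log 2 C.n) ℓs) := by
  simp only [altQ, accepts_simAlg_iff hid.1, simLabels_update, Function.update_self]
  constructor
  · rintro ⟨κ, -, -, h⟩
    exact ⟨_, fun v => by simp, h⟩
  · rintro ⟨ℓ, hℓ, h⟩
    obtain ⟨κ, hκ, hok, hpay⟩ := exists_cert hβ hid hℓ
    refine ⟨κ, hκ, hok, ?_⟩
    have : (fun u => (payload (κ u)).take (c * Nat.log 2 C.n)) = ℓ :=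
      funext fun u => by rw [hpay, List.take_of_length_le (hℓ u)]
    rwa [this]

lemma piC_of_piC_succ {α β : ℕ} (hβ : 1 ≤ β) {k : ℕ} {L : Set Config}
    (h : PiC α β (2 * (k + 1) + 1) L) : PiC α β (2 * (k + 1)) L := by
  obtain ⟨A, c, hA⟩ := h
  refine ⟨simAlg A c (2 * k + 1), c + 4 * (4 * β + 1), fun C hC ident hid => ?_⟩
  rw [hA C hC ident hid]
  have key := altQ_iff_of_map (c := c) (c' := c + 4 * (4 * β + 1)) (C := C)
    (P := accepts A C ident) (P' := accepts (simAlg A c (2 * k + 1)) C ident)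
    (F := truncLabels (c * Nat.log 2 C.n)) (M := 2 * k + 1) (a := 2) (a' := 1) (b₀ := true)
    (fun i _ ℓs ℓ _ => ⟨_, fun v => by simp, truncLabels_update _ _ _ _⟩)
    (fun i _ ℓs ℓ hℓ => ⟨ℓ, fun v => (hℓ v).trans (Nat.mul_le_mul_right _ (by omega)), by
      rw [truncLabels_update]
      congr 1
      exact funext fun u => List.take_of_length_le (hℓ u)⟩)
    (exists_accepts_simAlg_iff hβ hid) (2 * k + 1) 0 false (by omega) (by simp) (noLabels C)
  have hno : truncLabels (c * Nat.log 2 C.n) (noLabels C) = noLabels C := by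
    funext i u
    simp [truncLabels, noLabels]
  rw [hno, show 1 + (2 * k + 1) = 2 * (k + 1) by ring,
    show 2 + (2 * k + 1) = 2 * (k + 1) + 1 by ring] at key
  exact key.symm

/-- The algorithm that ignores the `m`-th labelling. -/
noncomputable def eraseAlg (A : LocalAlg) (m : ℕ) : LocalAlg :=
  algOfPred A.t
    (fun C ident ℓs v => A.run C ident (Function.update ℓs m fun _ => []) v = true)
    fun C C' ident ident' ℓ ℓ' v v' e h => by
      rw [← h]
      refine (BallEquiv.run_eq (e.withLabels _ _ fun i u hu => ?_)).symm
      simp only [Function.update_apply]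
      split_ifs
      · rfl
      · exact e.label i u hu

lemma piC_succ_of_piC {α β m : ℕ} {L : Set Config} (hm : m.bodd = false)
    (h : PiC α β m L) : PiC α β (m + 1) L := by
  obtain ⟨A, c, hA⟩ := h
  refine ⟨eraseAlg A m, c, fun C hC ident hid => ?_⟩
  rw [hA C hC ident hid]
  have key := altQ_iff_of_map (c := c) (c' := c) (C := C)
    (P := accepts A C ident) (P' := accepts (eraseAlg A m) C ident)
    (F := fun ℓs => Function.update ℓs m fun _ => []) (M := m) (a := 0) (a' := 1) (b₀ := false)
    (fun i hi ℓs ℓ hℓ => ⟨ℓ, hℓ, Function.update_comm hi.ne _ _ _⟩)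
    (fun i hi ℓs ℓ hℓ => ⟨ℓ, hℓ, Function.update_comm hi.ne _ _ _⟩)
    (fun ℓs => by
      simp only [altQ, eraseAlg, accepts_algOfPred, Function.update_idem]
      exact ⟨fun h => h (fun _ => []) fun v => by simp, fun h _ _ => h⟩)
    m 0 false (by omega) (by simp [hm]) (noLabels C)
  have hno : (Function.update (noLabels C) m fun _ => []) = noLabels C :=
    Function.update_eq_self m (noLabels C)
  rw [hno, zero_add, add_comm] at key
  exact key.symm

end LocalHierarchy

/-- For every `k ≥ 1`, `Π_{2k+1} = Π_{2k}`: a distributed language is in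
`Π_{2k+1}` iff it is in `Π_{2k}` (for any fixed constants `α` and `β ≥ 1` of the setting). -/
theorem pi_odd_collapse (α β : ℕ) (hβ : 1 ≤ β) (k : ℕ) (hk : 1 ≤ k)
    (L : Set Config) (hL : IsDistLang α L) :
    PiC α β (2 * k + 1) L ↔ PiC α β (2 * k) L := by
  constructor
  · obtain ⟨k, rfl⟩ := Nat.exists_eq_add_of_le' hk
    exact LocalHierarchy.piC_of_piC_succ hβ
  · exact LocalHierarchy.piC_succ_of_piC (by simp)
end

section
/- LD ⊆ Π_1 ⊆ LD^{#node}: every distributed language in LD is in Π_1, and every distributed language in Π_1 is decidable by a local algorithm that additionally receives at every node the number n of nodes of the graph. -/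
/-- A local algorithm which additionally receives, at every node, the number `n` of nodes
of the graph: its locality condition only constrains balls in graphs of the same size. -/
structure LocalAlgN where
  t : ℕ
  run : (C : Config) → (Fin C.n → ℕ) → Fin C.n → Bool
  isLocal : ∀ (C C' : Config), C.n = C'.n →
      ∀ (ident : Fin C.n → ℕ) (ident' : Fin C'.n → ℕ) (v : Fin C.n) (v' : Fin C'.n)
      (φ : (C.G.induce (ball C v t)) ≃g (C'.G.induce (ball C' v' t))),
      ((φ ⟨v, self_mem_ball C v t⟩).val = v') →
      (∀ u : ball C v t, C'.x (φ u).val = C.x u.val) →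
      (∀ u : ball C v t, ident' (φ u).val = ident u.val) →
      run C ident v = run C' ident' v'

/-- The class `LD^{#node}`: decidable by a local algorithm that additionally receives
the number of nodes at every node. -/
def LDnode (α β : ℕ) (L : Set Config) : Prop :=
  ∃ A : LocalAlgN, ∀ C : Config, BoundedInput α C →
    ∀ ident : Fin C.n → ℕ, IsIdAssignment β C ident →
      (C ∈ L ↔ ∀ v, A.run C ident v = true)

/-- The local algorithm running `A` on empty labels, whatever labels are given. -/
def LocalAlg.ignoreLabels (A : LocalAlg) : LocalAlg where
  t := A.t
  run C ident _ v := A.run C ident (noLabels C) v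
  isLocal C C' ident ident' _ _ v v' φ hv hx hid _ :=
    A.isLocal C C' ident ident' (noLabels C) (noLabels C') v v' φ hv hx hid fun _ _ => rfl

/-- Node `v` accepts under `A` for every single labelling of size `c · log₂ n`. -/
def LocalAlg.AcceptsAllAt (A : LocalAlg) (c : ℕ) (C : Config) (ident : Fin C.n → ℕ)
    (v : Fin C.n) : Prop :=
  ∀ ℓ, goodLabel c C ℓ → A.run C ident (Function.update (noLabels C) 0 ℓ) v = true

/-- When the numbers of nodes agree, acceptance under every labelling is transported along
isomorphisms of balls: a labelling of the target ball pulls back to one of the source. -/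
lemma LocalAlg.AcceptsAllAt.transport {A : LocalAlg} {c : ℕ} {C C' : Config} (hn : C.n = C'.n)
    {ident : Fin C.n → ℕ} {ident' : Fin C'.n → ℕ} {v : Fin C.n} {v' : Fin C'.n}
    (φ : (C.G.induce (ball C v A.t)) ≃g (C'.G.induce (ball C' v' A.t)))
    (hv : (φ ⟨v, self_mem_ball C v A.t⟩).val = v')
    (hx : ∀ u : ball C v A.t, C'.x (φ u).val = C.x u.val)
    (hid : ∀ u : ball C v A.t, ident' (φ u).val = ident u.val)
    (h : A.AcceptsAllAt c C ident v) : A.AcceptsAllAt c C' ident' v' := by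
  classical
  intro ℓ' hℓ'
  let ℓ : Fin C.n → List Bool := fun u =>
    if hu : u ∈ ball C v A.t then ℓ' (φ ⟨u, hu⟩).val else []
  have hℓ : goodLabel c C ℓ := by
    intro u
    by_cases hu : u ∈ ball C v A.t
    · simpa [ℓ, hu, hn] using hℓ' (φ ⟨u, hu⟩).val
    · simp [ℓ, hu]
  rw [← h ℓ hℓ]
  refine (A.isLocal C C' ident ident' _ _ v v' φ hv hx hid fun i u => ?_).symm
  rcases eq_or_ne i 0 with rfl | hi
  · simp [ℓ]
  · simp [hi, noLabels]

open Classical in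
/-- The local algorithm with knowledge of `n` in which every node simulates `A` on all
labellings of size `c · log₂ n`. -/
noncomputable def LocalAlg.checkAllLabels (A : LocalAlg) (c : ℕ) : LocalAlgN where
  t := A.t
  run C ident v := decide (A.AcceptsAllAt c C ident v)
  isLocal C C' hn ident ident' v v' φ hv hx hid := by
    refine decide_eq_decide.2 ⟨.transport hn φ hv hx hid, .transport hn.symm φ.symm ?_ ?_ ?_⟩
    · have : φ.symm ⟨v', self_mem_ball C' v' A.t⟩ = ⟨v, self_mem_ball C v A.t⟩ :=
        φ.symm_apply_eq.2 (Subtype.ext hv.symm)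
      rw [this]
    · intro u
      simpa using (hx (φ.symm u)).symm
    · intro u
      simpa using (hid (φ.symm u)).symm

/-- `LD ⊆ Π_1 ⊆ LD^{#node}` (note `LD = Σ_0`). -/
theorem ld_subset_pi1_subset_ldnode (α β : ℕ) (hβ : 1 ≤ β)
    (L : Set Config) (hL : IsDistLang α L) :
    (SigmaC α β 0 L → PiC α β 1 L) ∧ (PiC α β 1 L → LDnode α β L) := by
  constructor
  · rintro ⟨A, _, hA⟩
    refine ⟨A.ignoreLabels, 0, fun C hC ident hident => (hA C hC ident hident).trans ?_⟩
    exact ⟨fun h _ _ => h, fun h => h (fun _ => []) fun _ => by simp⟩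
  · rintro ⟨A, c, hA⟩
    refine ⟨A.checkAllLabels c, fun C hC ident hident => (hA C hC ident hident).trans ?_⟩
    simp only [LocalAlg.checkAllLabels, decide_eq_true_eq]
    exact ⟨fun h v ℓ hℓ => h ℓ hℓ v, fun h ℓ hℓ v => h v ℓ hℓ⟩
end

section
/- For all nonnegative integers k, c and t, there exist a positive integer n and a set L ⊆ {0,1}^n of binary words of length n such that no t-round local algorithm A using k labellings of size at most c·log₂ n satisfies, for every 0/1-labelled oriented path configuration w of length n: w ∈ L ⟺ ∃ℓ_1 ∀ℓ_2 ⋯ Q ℓ_k, A accepts (with the quantifier alternation pattern of Λ_k, i.e., starting with ∃ when k is odd and with ∀ when k is even). -/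
lemma pathGraph_connected_of_pos : ∀ (n : ℕ), 0 < n → (SimpleGraph.pathGraph n).Connected
  | n + 1, _ => SimpleGraph.pathGraph_connected n

/-- The 0/1-labelled oriented path configuration associated to a word `w ∈ {0,1}ⁿ`:
the path `v₁ — v₂ — ⋯ — vₙ` with input the single bit `w(vᵢ)` at node `vᵢ`. -/
def pathConfig (n : ℕ) (hn : 0 < n) (w : Fin n → Bool) : Config where
  n := n
  npos := hn
  G := SimpleGraph.pathGraph n
  conn := pathGraph_connected_of_pos n hn
  x := fun v => [w v]

/-- The fixed identity assignment `id(vᵢ) = i` on the oriented path. -/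
def pathIdent (n : ℕ) : Fin n → ℕ := fun v => v.val + 1

/-- Labellings whose labels are bounded by `c · log₂ n` and which are empty from index `k` on. -/
def BoundedLabels (k c n : ℕ) (ℓs : ℕ → Fin n → List Bool) : Prop :=
  (∀ i u, (ℓs i u).length ≤ c * Nat.log 2 n) ∧ ∀ i, k ≤ i → ∀ u, ℓs i u = []

lemma BoundedLabels.update {k c n i : ℕ} {ℓs : ℕ → Fin n → List Bool}
    (h : BoundedLabels k c n ℓs) (hi : i < k) {ℓ : Fin n → List Bool}
    (hℓ : ∀ u, (ℓ u).length ≤ c * Nat.log 2 n) :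
    BoundedLabels k c n (Function.update ℓs i ℓ) := by
  refine ⟨fun j u => ?_, fun j hj u => ?_⟩
  · by_cases hji : j = i
    · subst hji
      simpa using hℓ u
    · simpa [Function.update_of_ne hji] using h.1 j u
  · have hji : j ≠ i := by omega
    simpa [Function.update_of_ne hji] using h.2 j hj u

lemma altQ_congr {k c : ℕ} {C : Config} {P P' : (ℕ → Fin C.n → List Bool) → Prop}
    (hP : ∀ ℓs, BoundedLabels k c C.n ℓs → (P ℓs ↔ P' ℓs)) :
    ∀ (j i : ℕ) (b : Bool) (ℓs : ℕ → Fin C.n → List Bool), i + j ≤ k →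
      BoundedLabels k c C.n ℓs → (altQ c C P j i b ℓs ↔ altQ c C P' j i b ℓs)
  | 0, _, _, ℓs, _, h => hP ℓs h
  | j + 1, i, true, ℓs, hij, h => by
      refine exists_congr fun ℓ => and_congr_right fun hℓ => ?_
      exact altQ_congr hP j (i + 1) false _ (by omega) (h.update (by omega) hℓ)
  | j + 1, i, false, ℓs, hij, h => by
      refine forall_congr' fun ℓ => forall_congr' fun hℓ => ?_
      exact altQ_congr hP j (i + 1) true _ (by omega) (h.update (by omega) hℓ)

lemma pathGraph_walk_length {n : ℕ} {u v : Fin n} (p : (SimpleGraph.pathGraph n).Walk u v) :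
    (u : ℕ) ≤ v + p.length ∧ (v : ℕ) ≤ u + p.length := by
  induction p with
  | nil => simp
  | cons h p ih =>
    rw [SimpleGraph.pathGraph_adj] at h
    rw [SimpleGraph.Walk.length_cons]
    omega

lemma pathGraph_le_add_dist {n : ℕ} (u v : Fin n) :
    (u : ℕ) ≤ v + (SimpleGraph.pathGraph n).dist u v ∧
      (v : ℕ) ≤ u + (SimpleGraph.pathGraph n).dist u v := by
  obtain ⟨p, hp⟩ :=
    (pathGraph_connected_of_pos n u.pos).exists_walk_length_eq_dist u v
  exact hp ▸ pathGraph_walk_length p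

/-- A finite type of radius-`t` views: for each offset, an input bit and `k` encoded labels of
length at most `M`. -/
abbrev View (k t M : ℕ) : Type :=
  Fin (2 * t + 1) → Bool × (Fin k → Fin M → Option Bool)

/-- The radius-`t` view of `v` on a labelled path; positions beyond the ends are clamped. -/
def pathView (k t M : ℕ) {n : ℕ} (w : Fin n → Bool) (ℓs : ℕ → Fin n → List Bool) (v : Fin n) :
    View k t M := fun g =>
  let u : Fin n := ⟨min (v + g - t) (n - 1), by have := v.pos; omega⟩
  (w u, fun i a => (ℓs i u)[(a : ℕ)]?)

lemma eq_of_pathView_eq_of_near {k t M n : ℕ} {w w' : Fin n → Bool}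
    {ℓs ℓs' : ℕ → Fin n → List Bool} {v : Fin n}
    (h : pathView k t M w ℓs v = pathView k t M w' ℓs' v) {u : Fin n}
    (hvu : (v : ℕ) ≤ u + t) (huv : (u : ℕ) ≤ v + t) :
    w u = w' u ∧ ∀ i < k, ∀ a < M, (ℓs i u)[a]? = (ℓs' i u)[a]? := by
  have hu : (⟨min (v + (u + t - v) - t) (n - 1), by have := v.pos; omega⟩ : Fin n) = u := by
    ext
    simp only
    omega
  have hg := congrFun h ⟨u + t - v, by omega⟩
  simp only [pathView, hu, Prod.mk.injEq] at hg
  exact ⟨hg.1, fun i hi a ha => congrFun (congrFun hg.2 ⟨i, hi⟩) ⟨a, ha⟩⟩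

lemma List.eq_of_getElem?_eq_of_length_le {α : Type*} {l l' : List α} {M : ℕ}
    (hl : l.length ≤ M) (hl' : l'.length ≤ M) (h : ∀ a < M, l[a]? = l'[a]?) : l = l' := by
  refine List.ext_getElem? fun a => ?_
  by_cases ha : a < M
  · exact h a ha
  · rw [List.getElem?_eq_none (by omega), List.getElem?_eq_none (by omega)]

lemma LocalAlg.run_eq_of_pathView_eq (A : LocalAlg) {k c n : ℕ} (hn : 0 < n)
    {w w' : Fin n → Bool} {ℓs ℓs' : ℕ → Fin n → List Bool} {v : Fin n}
    (hℓ : BoundedLabels k c n ℓs) (hℓ' : BoundedLabels k c n ℓs')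
    (h : pathView k A.t (c * Nat.log 2 n) w ℓs v = pathView k A.t (c * Nat.log 2 n) w' ℓs' v) :
    A.run (pathConfig n hn w) (pathIdent n) ℓs v =
      A.run (pathConfig n hn w') (pathIdent n) ℓs' v := by
  have key : ∀ u ∈ ball (pathConfig n hn w) v A.t,
      w u = w' u ∧ ∀ i < k, ∀ a < c * Nat.log 2 n, (ℓs i u)[a]? = (ℓs' i u)[a]? := by
    intro u hu
    have hd : (SimpleGraph.pathGraph n).dist v u ≤ A.t := hu
    have := pathGraph_le_add_dist v u
    exact eq_of_pathView_eq_of_near h (by omega) (by omega)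
  refine A.isLocal (pathConfig n hn w) (pathConfig n hn w') (pathIdent n) (pathIdent n) ℓs ℓs' v v
    (SimpleGraph.Iso.refl) rfl (fun u => ?_) (fun _ => rfl) (fun i u => ?_)
  · exact congrArg (fun b => [b]) (key u u.2).1.symm
  · change ℓs' i u.1 = ℓs i u.1
    by_cases hi : i < k
    · exact (List.eq_of_getElem?_eq_of_length_le (hℓ.1 i _) (hℓ'.1 i _)
        ((key u u.2).2 i hi)).symm
    · exact (hℓ'.2 i (by omega) _).trans (hℓ.2 i (by omega) _).symm

/-- The pairs of a node and a view on which the algorithm accepts. -/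
def acceptedViews (A : LocalAlg) (k c n : ℕ) (hn : 0 < n) :
    Set (Fin n × View k A.t (c * Nat.log 2 n)) :=
  {p | ∃ w ℓs, BoundedLabels k c n ℓs ∧ pathView k A.t (c * Nat.log 2 n) w ℓs p.1 = p.2 ∧
    A.run (pathConfig n hn w) (pathIdent n) ℓs p.1 = true}

lemma accepts_iff_acceptedViews (A : LocalAlg) {k c n : ℕ} (hn : 0 < n) (w : Fin n → Bool)
    {ℓs : ℕ → Fin n → List Bool} (hℓ : BoundedLabels k c n ℓs) :
    accepts A (pathConfig n hn w) (pathIdent n) ℓs ↔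
      ∀ v, (v, pathView k A.t (c * Nat.log 2 n) w ℓs v) ∈ acceptedViews A k c n hn := by
  refine forall_congr' fun v => ⟨fun h => ⟨w, ℓs, hℓ, rfl, h⟩, ?_⟩
  rintro ⟨w', ℓs', hℓ', hv, h⟩
  exact (A.run_eq_of_pathView_eq hn hℓ hℓ' hv.symm).trans h

lemma mul_two_mul_add_one_lt_four_pow (D : ℕ) : D * (2 * D + 1) < 4 ^ D := by
  induction D with
  | zero => simp
  | succ D ih =>
    rw [pow_succ]
    rcases Nat.eq_zero_or_pos D with rfl | hD
    · norm_num
    · nlinarith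

lemma exists_card_views_lt (k c t : ℕ) :
    ∃ n : ℕ, 0 < n ∧ n * Fintype.card (View k t (c * Nat.log 2 n)) < 2 ^ n := by
  set D := 1 + (2 * t + 1) * (1 + 2 * c * k) with hD
  refine ⟨2 ^ (2 * D), by positivity, ?_⟩
  rw [Nat.log_pow (by norm_num)]
  simp only [Fintype.card_fun, Fintype.card_prod, Fintype.card_bool, Fintype.card_option,
    Fintype.card_fin]
  have h3 : ((2 + 1) ^ (c * (2 * D))) ^ k ≤ 2 ^ (2 * (c * (2 * D)) * k) := by
    rw [pow_mul 2 _ k, pow_mul 2 2]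
    gcongr
    norm_num
  calc 2 ^ (2 * D) * (2 * ((2 + 1) ^ (c * (2 * D))) ^ k) ^ (2 * t + 1)
      ≤ 2 ^ (2 * D) * (2 * 2 ^ (2 * (c * (2 * D)) * k)) ^ (2 * t + 1) := by gcongr
    _ = 2 ^ (2 * D + (1 + 2 * (c * (2 * D)) * k) * (2 * t + 1)) := by
        rw [pow_add 2 (2 * D), pow_mul 2 _ (2 * t + 1), pow_add 2 1, pow_one]
    _ < 2 ^ 2 ^ (2 * D) := by
        refine Nat.pow_lt_pow_right (by norm_num) ?_
        have h4 := mul_two_mul_add_one_lt_four_pow D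
        have h5 : (2 : ℕ) ^ (2 * D) = 4 ^ D := by rw [pow_mul]; norm_num
        have h6 : 2 * D + (1 + 2 * (c * (2 * D)) * k) * (2 * t + 1) ≤ D * (2 * D + 1) := by
          have h7 : D * (2 * D + 1)
              = 2 * D + (2 * t + 1) * (1 + 2 * c * k) * (2 * D) + D := by
            conv_lhs => rw [show D * (2 * D + 1) = D * (2 * D) + D by ring]
            conv_lhs => enter [1, 1]; rw [hD]
            ring
          have h8 : 2 * t + 1 ≤ D := by rw [hD]; nlinarith [Nat.zero_le ((2 * t + 1) * (2 * c * k))]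
          rw [h7]
          nlinarith [Nat.zero_le (t * D)]
        omega

/-- For all `k`, `c`, `t`, there are a length `n > 0` and a set
`L ⊆ {0,1}ⁿ` of words such that no `t`-round local algorithm using `k` labellings of size
at most `c · log₂ n` decides `L` on 0/1-labelled oriented path configurations via the
`Λ_k`-alternation of quantifiers (starting with `∃` for odd `k`, with `∀` for even `k`). -/
theorem language_escaping_fixed_parameters (k c t : ℕ) :
    ∃ (n : ℕ) (hn : 0 < n) (L : Set (Fin n → Bool)),
      ∀ A : LocalAlg, A.t = t →
        ¬ (∀ w : Fin n → Bool,
            w ∈ L ↔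
              altQ c (pathConfig n hn w)
                (accepts A (pathConfig n hn w) (pathIdent n)) k 0 (startEx k)
                (noLabels (pathConfig n hn w))) := by
  obtain ⟨n, hn, hlt⟩ := exists_card_views_lt k c t
  refine ⟨n, hn, ?_⟩
  by_contra! hall
  choose A hAt hA using hall
  have hempty : BoundedLabels k c n (fun _ _ => []) := ⟨by simp, by simp⟩
  let S (L : Set (Fin n → Bool)) : Set (Fin n × View k t (c * Nat.log 2 n)) :=
    hAt L ▸ acceptedViews (A L) k c n hn
  have hS : ∀ L w, ∀ ℓs, BoundedLabels k c n ℓs →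
      (accepts (A L) (pathConfig n hn w) (pathIdent n) ℓs ↔
        ∀ v, (v, pathView k t (c * Nat.log 2 n) w ℓs v) ∈ S L) := by
    intro L w ℓs hℓ
    rw [accepts_iff_acceptedViews (A L) hn w hℓ]
    have cast_mem : ∀ {s : ℕ} (hs : s = t)
        (T : Set (Fin n × View k s (c * Nat.log 2 n))) (v : Fin n),
        (v, pathView k s (c * Nat.log 2 n) w ℓs v) ∈ T ↔
          (v, pathView k t (c * Nat.log 2 n) w ℓs v) ∈
            (hs ▸ T : Set (Fin n × View k t (c * Nat.log 2 n))) := by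
      rintro s rfl T v
      rfl
    exact forall_congr' fun v => cast_mem (hAt L) _ v
  have hinj : Function.Injective S := by
    intro L L' hLL
    ext w
    rw [hA L w, hA L' w]
    refine altQ_congr (k := k) (fun ℓs hℓ => ?_) k 0 _ _ (by omega) hempty
    exact (hS L w ℓs hℓ).trans (hLL ▸ (hS L' w ℓs hℓ).symm)
  have hcard := Fintype.card_le_of_injective S hinj
  rw [Fintype.card_set, Fintype.card_set, Fintype.card_fun, Fintype.card_bool,
    Fintype.card_prod, Fintype.card_fin] at hcard
  have := (Nat.pow_le_pow_iff_right (by norm_num)).1 hcard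
  omega
end
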